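/- The all-E-graph-instance termination problem of equality saturation — given a finite signature Σ and a finite term rewriting system R over Σ, decide whether EqSat(R, G) terminates for every finite E-graph G over Σ — is undecidable: the Post correspondence problem many-one reduces to it via a computable map from PCP instances to term rewriting systems R such that the PCP instance has a solution if and only if EqSat(R, G) terminates for all finite E-graphs G. -/

import Mathlib

set_option autoImplicit false

/-! ## Terms over a signature -/

inductive Tm (F : Type) (ar : F → ℕ) (V : Type) : Type where
  | var : V → Tm F ar V
  | node : (f : F) → (Fin (ar f) → Tm F ar V) → Tm F ar V

namespace Tm

variable {F : Type} {ar : F → ℕ} {V W : Type}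

/-- Apply a renaming of variables/states. -/
def map (σ : V → W) : Tm F ar V → Tm F ar W
  | .var v => .var (σ v)
  | .node f ts => .node f fun i => (ts i).map σ

/-- Apply a substitution. -/
def subst (σ : V → Tm F ar W) : Tm F ar V → Tm F ar W
  | .var v => σ v
  | .node f ts => .node f fun i => (ts i).subst σ

/-- The set of variables occurring in a pattern. -/
def vars : Tm F ar V → Set V
  | .var v => {v}
  | .node _ ts => ⋃ i, (ts i).vars

end Tm

/-- Ground terms: terms with no variables. -/
abbrev GTm (F : Type) (ar : F → ℕ) : Type := Tm F ar Empty

/-- A ground term viewed as a term over `Σ ∪ V`. -/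
def GTm.embed {F : Type} {ar : F → ℕ} {V : Type} (t : GTm F ar) : Tm F ar V :=
  Tm.map (fun e => e.elim) t

/-- The (reflexive) subterm relation. -/
inductive Subterm {F : Type} {ar : F → ℕ} {V : Type} : Tm F ar V → Tm F ar V → Prop where
  | refl (t : Tm F ar V) : Subterm t t
  | node {u : Tm F ar V} {f : F} {ts : Fin (ar f) → Tm F ar V} (i : Fin (ar f)) :
      Subterm u (ts i) → Subterm u (.node f ts)

theorem Subterm.trans' {F : Type} {ar : F → ℕ} {V : Type} {a b c : Tm F ar V}
    (h1 : Subterm a b) (h2 : Subterm b c) : Subterm a c := by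
  induction h2 with
  | refl => exact h1
  | node i _ ih => exact Subterm.node i ih

theorem Subterm.child {F : Type} {ar : F → ℕ} {V : Type} {f : F}
    {ts : Fin (ar f) → Tm F ar V} {c : Tm F ar V} (i : Fin (ar f))
    (h : Subterm (.node f ts) c) : Subterm (ts i) c :=
  Subterm.trans' (Subterm.node i (Subterm.refl _)) h

/-! ## Tree automata and E-graphs -/

/-- A (bottom-up, possibly infinite) tree automaton: a set of states together with
transitions `f(q₁,…,qₖ) → q`. -/
structure Automaton (F : Type) (ar : F → ℕ) : Type 1 where
  Q : Type
  trans : (f : F) → Set ((Fin (ar f) → Q) × Q)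

/-- `Accepts A t q` formalizes `t →*_A q`: the term `t ∈ T(Σ ∪ Q)` rewrites to the state `q`. -/
inductive Accepts {F : Type} {ar : F → ℕ} (A : Automaton F ar) : Tm F ar A.Q → A.Q → Prop where
  | var (q : A.Q) : Accepts A (.var q) q
  | node {f : F} {ts : Fin (ar f) → Tm F ar A.Q} {qs : Fin (ar f) → A.Q} {q : A.Q} :
      (∀ i, Accepts A (ts i) (qs i)) → (qs, q) ∈ A.trans f → Accepts A (.node f ts) q

/-- A ground term `t ∈ T(Σ)` is accepted by the state `q`, i.e. `t →*_A q`. -/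
def Automaton.AcceptsG {F : Type} {ar : F → ℕ} (A : Automaton F ar) (t : GTm F ar) (q : A.Q) : Prop :=
  Accepts A (GTm.embed t) q

/-- Deterministic: every ground term is accepted by at most one state. -/
def Automaton.Deterministic {F : Type} {ar : F → ℕ} (A : Automaton F ar) : Prop :=
  ∀ (t : GTm F ar) (q1 q2 : A.Q), A.AcceptsG t q1 → A.AcceptsG t q2 → q1 = q2

/-- Reachable: every state accepts some ground term. -/
def Automaton.ReachableA {F : Type} {ar : F → ℕ} (A : Automaton F ar) : Prop :=
  ∀ q : A.Q, ∃ t : GTm F ar, A.AcceptsG t q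

/-- An E-graph is a deterministic and reachable tree automaton. -/
structure EGraph (F : Type) (ar : F → ℕ) extends Automaton F ar where
  det : toAutomaton.Deterministic
  reach : toAutomaton.ReachableA

/-- A homomorphism of tree automata: maps states to states, preserving all transitions. -/
structure AHom {F : Type} {ar : F → ℕ} (A B : Automaton F ar) : Type where
  toFun : A.Q → B.Q
  map_trans : ∀ (f : F) (qs : Fin (ar f) → A.Q) (q : A.Q),
    (qs, q) ∈ A.trans f → (fun i => toFun (qs i), toFun q) ∈ B.trans f

/-- `A ⊑ B` : there exists a homomorphism from `A` to `B`. -/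
def ALe {F : Type} {ar : F → ℕ} (A B : Automaton F ar) : Prop := Nonempty (AHom A B)

def EGraph.Le {F : Type} {ar : F → ℕ} (G H : EGraph F ar) : Prop :=
  ALe G.toAutomaton H.toAutomaton

/-- Isomorphism of E-graphs: mutually inverse homomorphisms. -/
def EGraph.Iso {F : Type} {ar : F → ℕ} (G H : EGraph F ar) : Prop :=
  ∃ (h : AHom G.toAutomaton H.toAutomaton) (h' : AHom H.toAutomaton G.toAutomaton),
    (∀ q, h'.toFun (h.toFun q) = q) ∧ (∀ q, h.toFun (h'.toFun q) = q)

/-- The partial congruence relation `≈_G` induced by an E-graph: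
two ground terms are related iff some state accepts both. -/
def EGraph.eqv {F : Type} {ar : F → ℕ} (G : EGraph F ar) (t1 t2 : GTm F ar) : Prop :=
  ∃ q : G.Q, G.toAutomaton.AcceptsG t1 q ∧ G.toAutomaton.AcceptsG t2 q

/-- A finite E-graph: finitely many states and transitions. -/
def EGraph.IsFinite {F : Type} {ar : F → ℕ} (G : EGraph F ar) : Prop :=
  Finite G.Q ∧ ∀ f : F, (G.trans f).Finite

/-! ## Partial congruence relations -/

/-- A partial congruence relation (PCR) on ground terms: a symmetric, transitive,
congruent and reachable binary relation. -/
structure IsPCR {F : Type} {ar : F → ℕ} (E : GTm F ar → GTm F ar → Prop) : Prop where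
  symm : ∀ {t1 t2 : GTm F ar}, E t1 t2 → E t2 t1
  trans : ∀ {t1 t2 t3 : GTm F ar}, E t1 t2 → E t2 t3 → E t1 t3
  congruent : ∀ (f : F) (s t : Fin (ar f) → GTm F ar),
    (∀ i, E (s i) (t i)) → E (.node f s) (.node f s) → E (.node f s) (.node f t)
  reachable : ∀ (f : F) (s : Fin (ar f) → GTm F ar),
    E (.node f s) (.node f s) → ∀ i, E (s i) (s i)

/-- The join of two PCRs: the smallest PCR containing both. -/
def joinPCR {F : Type} {ar : F → ℕ} (E1 E2 : GTm F ar → GTm F ar → Prop)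
    (a b : GTm F ar) : Prop :=
  ∀ E : GTm F ar → GTm F ar → Prop, IsPCR E →
    (∀ x y, E1 x y → E x y) → (∀ x y, E2 x y → E x y) → E a b

/-! ## Term rewriting systems -/

/-- A term rewriting system: a finite set of rules `lhs → rhs` between patterns
(terms with variables drawn from `ℕ`), with `Var(rhs) ⊆ Var(lhs)`. -/
structure TRS (F : Type) (ar : F → ℕ) where
  rules : Set (Tm F ar ℕ × Tm F ar ℕ)
  finite : rules.Finite
  var_cond : ∀ r ∈ rules, Tm.vars r.2 ⊆ Tm.vars r.1

/-- The ground rewrite relation `→_R` determined by a TRS. -/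
inductive RWStep {F : Type} {ar : F → ℕ} (R : TRS F ar) : GTm F ar → GTm F ar → Prop where
  | rule {l r : Tm F ar ℕ} (h : (l, r) ∈ R.rules) (σ : ℕ → GTm F ar) :
      RWStep R (l.subst σ) (r.subst σ)
  | congr {f : F} {ts : Fin (ar f) → GTm F ar} {i : Fin (ar f)} {u : GTm F ar} :
      RWStep R (ts i) u → RWStep R (.node f ts) (.node f (Function.update ts i u))

/-- `≈_R` : the reflexive-symmetric-transitive closure of `→_R`. -/
def TRSEqv {F : Type} {ar : F → ℕ} (R : TRS F ar) : GTm F ar → GTm F ar → Prop :=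
  Relation.ReflTransGen fun a b => RWStep R a b ∨ RWStep R b a

/-! ## E-matching, insertion and congruence closure -/

/-- An e-match of a rule in an E-graph: a substitution `σ` into E-classes and a root
E-class `c` with `lhs[σ] →*_G c`. -/
structure EMatch {F : Type} {ar : F → ℕ} (R : TRS F ar) (G : EGraph F ar) : Type where
  lhs : Tm F ar ℕ
  rhs : Tm F ar ℕ
  mem : (lhs, rhs) ∈ R.rules
  sub : ℕ → G.Q
  root : G.Q
  acc : Accepts G.toAutomaton (Tm.map sub lhs) root

/-- Fresh states of the flattenings added by the match/apply operator: one state per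
(match, subterm of the instantiated right-hand side). -/
def MExtra {F : Type} {ar : F → ℕ} (R : TRS F ar) (G : EGraph F ar) : Type :=
  { p : EMatch R G × Tm F ar G.Q // Subterm p.2 (Tm.map p.1.sub p.1.rhs) }

open Classical in
/-- The state of the flattening `FL(rhs[σ] →* c)` associated to a subterm `u` of `rhs[σ]`:
states at the leaves are kept, the root is mapped to `c = root`, and all other subterms
get a fresh state. -/
noncomputable def stateOf {F : Type} {ar : F → ℕ} (R : TRS F ar) (G : EGraph F ar)
    (m : EMatch R G) :
    (u : Tm F ar G.Q) → Subterm u (Tm.map m.sub m.rhs) → G.Q ⊕ MExtra R G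
  | .var q, _ => Sum.inl q
  | .node f ts, h =>
      if Tm.node f ts = Tm.map m.sub m.rhs then Sum.inl m.root
      else Sum.inr ⟨(m, Tm.node f ts), h⟩

/-- The match/apply operator `T_R`: the (possibly non-deterministic) tree automaton
obtained from `G` by inserting the flattening `FL(rhs[σ] →* c)` for every e-match. -/
noncomputable def TRaut {F : Type} {ar : F → ℕ} (R : TRS F ar) (G : EGraph F ar) :
    Automaton F ar where
  Q := G.Q ⊕ MExtra R G
  trans f := { p |
    (∃ (qs : Fin (ar f) → G.Q) (q : G.Q), (qs, q) ∈ G.trans f ∧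
      p = (fun i => Sum.inl (qs i), Sum.inl q)) ∨
    (∃ (m : EMatch R G) (ts : Fin (ar f) → Tm F ar G.Q)
        (h : Subterm (.node f ts) (Tm.map m.sub m.rhs)),
      p = (fun i => stateOf R G m (ts i) (Subterm.child i h),
           stateOf R G m (.node f ts) h)) }

/-- `G` is the congruence closure (rebuilding) of the automaton `A`: the ⊑-least E-graph
above `A`. -/
def IsCC {F : Type} {ar : F → ℕ} (A : Automaton F ar) (G : EGraph F ar) : Prop :=
  ALe A G.toAutomaton ∧ ∀ H : EGraph F ar, ALe A H.toAutomaton → EGraph.Le G H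

/-- `H` is (up to isomorphism) the result of the immediate consequence operator
`ICO_R = CC ∘ T_R` applied to `G`. -/
def IsICO {F : Type} {ar : F → ℕ} (R : TRS F ar) (G H : EGraph F ar) : Prop :=
  IsCC (TRaut R G) H

/-- `S` is the sequence of iterates `S i = ICO_R^(i)(G)`. -/
def IterSeq {F : Type} {ar : F → ℕ} (R : TRS F ar) (G : EGraph F ar)
    (S : ℕ → EGraph F ar) : Prop :=
  S 0 = G ∧ ∀ i, IsICO R (S i) (S (i + 1))

/-- `H` is a least upper bound of the sequence `S` of E-graphs. -/
def IsLUBseq {F : Type} {ar : F → ℕ} (S : ℕ → EGraph F ar) (H : EGraph F ar) : Prop :=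
  (∀ i, (S i).Le H) ∧ ∀ H' : EGraph F ar, (∀ i, (S i).Le H') → H.Le H'

/-- `H` is a least upper bound of the family `Gs` of E-graphs. -/
def IsLUBfam {F : Type} {ar : F → ℕ} {I : Type} (Gs : I → EGraph F ar)
    (H : EGraph F ar) : Prop :=
  (∀ i, (Gs i).Le H) ∧ ∀ H' : EGraph F ar, (∀ i, (Gs i).Le H') → H.Le H'

/-- `H = EqSat(R, G) = ⊔_{i ≥ 0} ICO_R^(i)(G)`. -/
def IsEqSat {F : Type} {ar : F → ℕ} (R : TRS F ar) (G H : EGraph F ar) : Prop :=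
  ∃ S : ℕ → EGraph F ar, IterSeq R G S ∧ IsLUBseq S H

/-- `H` is a model of the TRS `R`. -/
def ModelTRS {F : Type} {ar : F → ℕ} (R : TRS F ar) (H : EGraph F ar) : Prop :=
  ∀ r ∈ R.rules, ∀ (σ : ℕ → H.Q) (c : H.Q),
    Accepts H.toAutomaton (Tm.map σ r.1) c → Accepts H.toAutomaton (Tm.map σ r.2) c

/-- `H` is a model of the pair `(R, G)`. -/
def IsModelOf {F : Type} {ar : F → ℕ} (R : TRS F ar) (G H : EGraph F ar) : Prop :=
  G.Le H ∧ ModelTRS R H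

/-- `H` is a universal model of the pair `(R, G)`. -/
def IsUniversalModel {F : Type} {ar : F → ℕ} (R : TRS F ar) (G H : EGraph F ar) : Prop :=
  IsModelOf R G H ∧ ∀ H' : EGraph F ar, IsModelOf R G H' → H.Le H'

/-- `G` is (up to isomorphism) the flattening `FL(t →* c)` of a ground term `t`:
the ⊑-least E-graph representing `t`. -/
def IsTermEG {F : Type} {ar : F → ℕ} (t : GTm F ar) (G : EGraph F ar) : Prop :=
  (∃ c, G.toAutomaton.AcceptsG t c) ∧
  ∀ H : EGraph F ar, (∃ c, H.toAutomaton.AcceptsG t c) → G.Le H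

/-- Equality saturation terminates on `(R, G)`: the sequence of iterates
`ICO_R^(i)(G)` is eventually constant up to isomorphism. -/
def EqSatTerminates {F : Type} {ar : F → ℕ} (R : TRS F ar) (G : EGraph F ar) : Prop :=
  ∃ S : ℕ → EGraph F ar, IterSeq R G S ∧ ∃ n, ∀ m, n ≤ m → (S m).Iso (S n)

/-! ## A structural Gödel encoding of EqSat problem instances -/

/-- The branching shape of terms, for the `WType` encoding. -/
def TmShape (n : ℕ) (ar : Fin n → ℕ) (V : Type) : Fin n ⊕ V → Type
  | Sum.inl f => Fin (ar f)
  | Sum.inr _ => Empty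

instance (n : ℕ) (ar : Fin n → ℕ) (V : Type) (x : Fin n ⊕ V) : Fintype (TmShape n ar V x) := by
  cases x with
  | inl f => exact inferInstanceAs (Fintype (Fin _))
  | inr v => exact inferInstanceAs (Fintype Empty)

instance (n : ℕ) (ar : Fin n → ℕ) (V : Type) (x : Fin n ⊕ V) : Encodable (TmShape n ar V x) := by
  cases x with
  | inl f => exact inferInstanceAs (Encodable (Fin _))
  | inr v => exact inferInstanceAs (Encodable Empty)

def Tm.toW {n : ℕ} {ar : Fin n → ℕ} {V : Type} : Tm (Fin n) ar V → WType (TmShape n ar V)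
  | .var v => ⟨Sum.inr v, fun e => nomatch e⟩
  | .node f ts => ⟨Sum.inl f, fun i => (ts i).toW⟩

def Tm.ofW {n : ℕ} {ar : Fin n → ℕ} {V : Type} : WType (TmShape n ar V) → Tm (Fin n) ar V
  | ⟨Sum.inl f, c⟩ => .node f fun i => Tm.ofW (c i)
  | ⟨Sum.inr v, _⟩ => .var v

theorem Tm.ofW_toW {n : ℕ} {ar : Fin n → ℕ} {V : Type} :
    ∀ t : Tm (Fin n) ar V, Tm.ofW (Tm.toW t) = t
  | .var v => rfl
  | .node f ts => by
      simp only [Tm.toW, Tm.ofW]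
      exact congrArg (Tm.node f) (funext fun i => Tm.ofW_toW (ts i))

theorem Tm.toW_ofW {n : ℕ} {ar : Fin n → ℕ} {V : Type} :
    ∀ w : WType (TmShape n ar V), Tm.toW (Tm.ofW w) = w
  | ⟨Sum.inl f, c⟩ => by
      simp only [Tm.ofW, Tm.toW]
      exact congrArg (WType.mk (Sum.inl f)) (funext fun i => Tm.toW_ofW (c i))
  | ⟨Sum.inr v, c⟩ => by
      simp only [Tm.ofW, Tm.toW]
      exact congrArg (WType.mk (Sum.inr v)) (funext fun e => nomatch e)

/-- Terms over the signature `Fin n` are equivalent to a W-type. -/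
def tmEquivW (n : ℕ) (ar : Fin n → ℕ) (V : Type) : Tm (Fin n) ar V ≃ WType (TmShape n ar V) where
  toFun := Tm.toW
  invFun := Tm.ofW
  left_inv := Tm.ofW_toW
  right_inv := Tm.toW_ofW

/-- A structural Gödel encoding of terms. -/
instance (n : ℕ) (ar : Fin n → ℕ) (V : Type) [Encodable V] : Encodable (Tm (Fin n) ar V) :=
  Encodable.ofEquiv _ (tmEquivW n ar V)




/-- A problem instance of the all-E-graph-instance termination problem: a finite
signature (given by the number `n` of symbols and their arities) and a finite list of
rewrite rules. -/
abbrev TRSInstance : Type :=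
  Σ n : ℕ, Σ ar : Fin n → ℕ, List (Tm (Fin n) ar ℕ × Tm (Fin n) ar ℕ)

/-- The given instance determines a well-formed TRS on which equality saturation
terminates for every finite input E-graph. -/
def AllEGraphTerminates (inst : TRSInstance) : Prop :=
  ∃ R : TRS (Fin inst.1) inst.2.1, R.rules = { r | r ∈ inst.2.2 } ∧
    ∀ G : EGraph (Fin inst.1) inst.2.1, G.IsFinite → EqSatTerminates R G

/-- An instance of the Post correspondence problem: two finite lists of words over a
(countable) alphabet, given as a list of pairs `(αᵢ, βᵢ)`. -/
abbrev PCPInstance : Type := List (List ℕ × List ℕ)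

/-- The PCP instance has a solution: a non-empty sequence of indices `i₁,…,iₖ` with
`α_{i₁}⋯α_{iₖ} = β_{i₁}⋯β_{iₖ}`. -/
def PCPSolvable (L : PCPInstance) : Prop :=
  ∃ ix : List ℕ, ix ≠ [] ∧ (∀ i ∈ ix, i < L.length) ∧
    (ix.map fun i => (L.getD i ([], [])).1).flatten =
      (ix.map fun i => (L.getD i ([], [])).2).flatten

/-! ## Accepting runs and homomorphisms -/

section EGraphTheory

variable {F : Type} {ar : F → ℕ} {V W : Type}

theorem Tm.map_map {X : Type} (σ : V → W) (τ : W → X) (t : Tm F ar V) :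
    (t.map σ).map τ = t.map (τ ∘ σ) := by
  induction t with
  | var v => rfl
  | node f ts ih => simp only [Tm.map, ih]

theorem Tm.map_embed (σ : V → W) (t : GTm F ar) :
    (GTm.embed t : Tm F ar V).map σ = GTm.embed t := by
  unfold GTm.embed
  rw [Tm.map_map]
  congr 1
  funext e
  exact e.elim

theorem Accepts.map_hom {A B : Automaton F ar} (h : AHom A B) {t : Tm F ar A.Q} {q : A.Q}
    (hq : Accepts A t q) : Accepts B (t.map h.toFun) (h.toFun q) := by
  induction hq with
  | var q => exact .var _
  | node _ hmem ih => exact .node ih (h.map_trans _ _ _ hmem)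

theorem Automaton.AcceptsG.map_hom {A B : Automaton F ar} (h : AHom A B) {t : GTm F ar} {q : A.Q}
    (hq : A.AcceptsG t q) : B.AcceptsG t (h.toFun q) := by
  have := Accepts.map_hom h hq
  rwa [Tm.map_embed] at this

theorem acceptsG_node {A : Automaton F ar} {f : F} {ts : Fin (ar f) → GTm F ar} {q : A.Q} :
    A.AcceptsG (.node f ts) q ↔
      ∃ qs : Fin (ar f) → A.Q, (∀ i, A.AcceptsG (ts i) (qs i)) ∧ (qs, q) ∈ A.trans f := by
  constructor
  · intro h
    cases h with
    | node h1 h2 => exact ⟨_, h1, h2⟩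
  · rintro ⟨qs, h1, h2⟩
    exact Accepts.node h1 h2

theorem EGraph.trans_det (G : EGraph F ar) {f : F} {qs : Fin (ar f) → G.Q} {q q' : G.Q}
    (h : (qs, q) ∈ G.trans f) (h' : (qs, q') ∈ G.trans f) : q = q' := by
  choose t ht using fun i => G.reach (qs i)
  exact G.det (.node f t) q q' (acceptsG_node.2 ⟨qs, ht, h⟩) (acceptsG_node.2 ⟨qs, ht, h'⟩)

theorem EGraph.accepts_det (G : EGraph F ar) {t : Tm F ar G.Q} {q q' : G.Q}
    (h : Accepts G.toAutomaton t q) (h' : Accepts G.toAutomaton t q') : q = q' := by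
  induction h generalizing q' with
  | var q => cases h'; rfl
  | node _ hmem ih =>
    cases h' with
    | node h1 h2 =>
      have := funext fun i => ih i (h1 i)
      subst this
      exact G.trans_det hmem h2

theorem Accepts.subst {A : Automaton F ar} {σ : ℕ → GTm F ar} {τ : ℕ → A.Q} {t : Tm F ar ℕ}
    {q : A.Q} (hσ : ∀ x ∈ t.vars, A.AcceptsG (σ x) (τ x)) (h : Accepts A (t.map τ) q) :
    A.AcceptsG (t.subst σ) q := by
  induction t generalizing q with
  | var v => cases h; exact hσ v rfl
  | node f ts ih =>
    cases h with
    | node h1 h2 =>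
      exact acceptsG_node.2
        ⟨_, fun i => ih i (fun x hx => hσ x (Set.mem_iUnion.2 ⟨i, hx⟩)) (h1 i), h2⟩

theorem Automaton.AcceptsG.of_subst {A : Automaton F ar} {σ : ℕ → GTm F ar} {τ : ℕ → A.Q}
    {t : Tm F ar ℕ} {q : A.Q} (hσ : ∀ x ∈ t.vars, ∀ q', A.AcceptsG (σ x) q' → q' = τ x)
    (h : A.AcceptsG (t.subst σ) q) : Accepts A (t.map τ) q := by
  induction t generalizing q with
  | var v =>
    rw [hσ v rfl q h]
    exact .var _
  | node f ts ih =>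
    obtain ⟨qs, h1, h2⟩ := acceptsG_node.1 h
    exact .node (fun i => ih i (fun x hx => hσ x (Set.mem_iUnion.2 ⟨i, hx⟩)) (h1 i)) h2

theorem Automaton.AcceptsG.exists_var {A : Automaton F ar} {σ : ℕ → GTm F ar}
    {t : Tm F ar ℕ} {q : A.Q} (h : A.AcceptsG (t.subst σ) q) {x : ℕ} (hx : x ∈ t.vars) :
    ∃ q', A.AcceptsG (σ x) q' := by
  induction t generalizing q with
  | var v => cases hx; exact ⟨q, h⟩
  | node f ts ih =>
    obtain ⟨qs, h1, -⟩ := acceptsG_node.1 h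
    obtain ⟨i, hi⟩ := Set.mem_iUnion.1 hx
    exact ih i (h1 i) hi

theorem Accepts.exists_subterm {A : Automaton F ar} {h : W → A.Q} {u t : Tm F ar W}
    (hu : Subterm u t) {q : A.Q} (ht : Accepts A (t.map h) q) : ∃ q', Accepts A (u.map h) q' := by
  induction hu generalizing q with
  | refl => exact ⟨q, ht⟩
  | node i _ ih =>
    cases ht with
    | node h1 _ => exact ih (h1 i)

/-! ## E-graphs and partial congruence relations -/

theorem EGraph.eqv_isPCR (G : EGraph F ar) : IsPCR G.eqv where
  symm := fun ⟨q, h1, h2⟩ => ⟨q, h2, h1⟩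
  trans := by
    rintro t1 t2 t3 ⟨q, h1, h2⟩ ⟨q', h3, h4⟩
    obtain rfl := G.det _ _ _ h2 h3
    exact ⟨q, h1, h4⟩
  congruent := by
    rintro f s t hst ⟨q, hq, -⟩
    refine ⟨q, hq, ?_⟩
    obtain ⟨qs, h1, h2⟩ := acceptsG_node.1 hq
    refine acceptsG_node.2 ⟨qs, fun i => ?_, h2⟩
    obtain ⟨q', h3, h4⟩ := hst i
    rwa [G.det _ _ _ (h1 i) h3]
  reachable := by
    rintro f s ⟨q, hq, -⟩ i
    obtain ⟨qs, h1, -⟩ := acceptsG_node.1 hq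
    exact ⟨qs i, h1 i, h1 i⟩

theorem EGraph.eqv_self {G : EGraph F ar} {t : GTm F ar} :
    G.eqv t t ↔ ∃ q, G.AcceptsG t q :=
  ⟨fun ⟨q, h, _⟩ => ⟨q, h⟩, fun ⟨q, h⟩ => ⟨q, h, h⟩⟩

theorem EGraph.Le.eqv_mono {G H : EGraph F ar} (h : G.Le H) {a b : GTm F ar}
    (hab : G.eqv a b) : H.eqv a b := by
  obtain ⟨h⟩ := h
  obtain ⟨q, h1, h2⟩ := hab
  exact ⟨h.toFun q, h1.map_hom h, h2.map_hom h⟩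

theorem EGraph.le_of_eqv {G H : EGraph F ar} (h : ∀ a b, G.eqv a b → H.eqv a b) : G.Le H := by
  choose t ht using G.reach
  choose φ hφ using fun q => EGraph.eqv_self.1 (h _ _ (EGraph.eqv_self.2 ⟨q, ht q⟩))
  refine ⟨⟨φ, fun f qs q hq => ?_⟩⟩
  obtain ⟨q', h1, h2⟩ := h (.node f fun i => t (qs i)) (t q)
    ⟨q, acceptsG_node.2 ⟨qs, fun i => ht _, hq⟩, ht q⟩
  obtain rfl := H.det _ _ _ (hφ q) h2
  obtain ⟨qs', h3, h4⟩ := acceptsG_node.1 h1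
  have : qs' = fun i => φ (qs i) := funext fun i => H.det _ _ _ (h3 i) (hφ _)
  rwa [this] at h4

theorem EGraph.Le.iso {G H : EGraph F ar} (h : G.Le H) (h' : H.Le G) : G.Iso H := by
  obtain ⟨h⟩ := h
  obtain ⟨h'⟩ := h'
  refine ⟨h, h', fun q => ?_, fun q => ?_⟩
  · obtain ⟨t, ht⟩ := G.reach q
    exact G.det _ _ _ ((ht.map_hom h).map_hom h') ht
  · obtain ⟨t, ht⟩ := H.reach q
    exact H.det _ _ _ ((ht.map_hom h').map_hom h) ht

/-- The domain of a partial congruence relation. -/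
def PCRDom (E : GTm F ar → GTm F ar → Prop) : Type := {t : GTm F ar // E t t}

/-- A partial congruence relation is an equivalence relation on its domain. -/
def IsPCR.setoid {E : GTm F ar → GTm F ar → Prop} (hE : IsPCR E) : Setoid (PCRDom E) where
  r a b := E a.1 b.1
  iseqv := ⟨fun a => a.2, hE.symm, hE.trans⟩

/-- The automaton whose states are the classes of a partial congruence relation. -/
def IsPCR.automaton {E : GTm F ar → GTm F ar → Prop} (hE : IsPCR E) : Automaton F ar where
  Q := Quotient hE.setoid
  trans f := {p | ∃ (s : Fin (ar f) → PCRDom E) (h : E (.node f fun i => (s i).1)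
    (.node f fun i => (s i).1)), p = (fun i => Quotient.mk _ (s i), Quotient.mk _ ⟨_, h⟩)}

theorem IsPCR.acceptsG_automaton {E : GTm F ar → GTm F ar → Prop} (hE : IsPCR E) {t : GTm F ar}
    {q : hE.automaton.Q} :
    hE.automaton.AcceptsG t q ↔ ∃ h : E t t, q = Quotient.mk hE.setoid ⟨t, h⟩ := by
  induction t generalizing q with
  | var v => exact v.elim
  | node f ts ih =>
    rw [acceptsG_node]
    constructor
    · rintro ⟨qs, h1, s, h2, h3⟩
      obtain ⟨rfl, rfl⟩ := Prod.mk.inj h3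
      have h4 : ∀ i, E (s i).1 (ts i) := fun i => by
        obtain ⟨_, h5⟩ := (ih i).1 (h1 i)
        exact Quotient.exact (s := hE.setoid) h5
      have h6 := hE.congruent f _ _ h4 h2
      exact ⟨hE.trans (hE.symm h6) h6, Quotient.sound (s := hE.setoid) h6⟩
    · rintro ⟨h, rfl⟩
      have h' := hE.reachable f ts h
      exact ⟨fun i => Quotient.mk _ ⟨ts i, h' i⟩, fun i => (ih i).2 ⟨h' i, rfl⟩,
        fun i => ⟨ts i, h' i⟩, h, rfl⟩

/-- The E-graph of a partial congruence relation. -/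
def IsPCR.egraph {E : GTm F ar → GTm F ar → Prop} (hE : IsPCR E) : EGraph F ar where
  toAutomaton := hE.automaton
  det t q1 q2 h1 h2 := by
    obtain ⟨_, rfl⟩ := hE.acceptsG_automaton.1 h1
    obtain ⟨_, rfl⟩ := hE.acceptsG_automaton.1 h2
    rfl
  reach q := by
    induction q using Quotient.inductionOn with
    | _ t => exact ⟨t.1, hE.acceptsG_automaton.2 ⟨t.2, rfl⟩⟩

theorem IsPCR.eqv_egraph {E : GTm F ar → GTm F ar → Prop} (hE : IsPCR E) {a b : GTm F ar} :
    hE.egraph.eqv a b ↔ E a b := by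
  constructor
  · rintro ⟨q, h1, h2⟩
    obtain ⟨_, rfl⟩ := hE.acceptsG_automaton.1 h1
    obtain ⟨_, h⟩ := hE.acceptsG_automaton.1 h2
    exact Quotient.exact (s := hE.setoid) h
  · intro h
    have ha := hE.trans h (hE.symm h)
    exact ⟨Quotient.mk _ ⟨a, ha⟩, hE.acceptsG_automaton.2 ⟨ha, rfl⟩,
      hE.acceptsG_automaton.2 ⟨hE.trans (hE.symm h) h, Quotient.sound (s := hE.setoid) h⟩⟩

/-! ## The immediate consequence operator on partial congruence relations -/

/-- `E'` contains `E` and all one-step consequences of the rules of `R` on the terms of `E`. -/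
structure Closed (R : TRS F ar) (E E' : GTm F ar → GTm F ar → Prop) : Prop where
  le : ∀ {a b}, E a b → E' a b
  rule : ∀ {l r : Tm F ar ℕ}, (l, r) ∈ R.rules → ∀ σ : ℕ → GTm F ar,
    E (l.subst σ) (l.subst σ) → E' (l.subst σ) (r.subst σ)

/-- No right-hand side is a bare variable. -/
def TRS.NodeRhs (R : TRS F ar) : Prop := ∀ p ∈ R.rules, ∀ x, p.2 ≠ .var x

theorem accepts_TRaut (R : TRS F ar) (G : EGraph F ar) (m : EMatch R G) {u : Tm F ar G.Q}
    (hu : Subterm u (m.rhs.map m.sub)) :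
    Accepts (TRaut R G) (u.map Sum.inl) (stateOf R G m u hu) := by
  induction u with
  | var q => exact .var _
  | node f ts ih =>
    exact .node (fun i => ih i (Subterm.child i hu)) (Or.inr ⟨m, ts, hu, rfl⟩)

theorem closed_of_le {R : TRS F ar} (hR : R.NodeRhs) {G H : EGraph F ar}
    (h : ALe (TRaut R G) H.toAutomaton) : Closed R G.eqv H.eqv := by
  obtain ⟨h⟩ := h
  let g : AHom G.toAutomaton H.toAutomaton :=
    ⟨fun q => h.toFun (.inl q), fun f qs q hq => h.map_trans f (fun i => .inl (qs i)) (.inl q)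
      (Or.inl ⟨qs, q, hq, rfl⟩)⟩
  refine ⟨fun hab => EGraph.Le.eqv_mono ⟨g⟩ hab, fun {l r} hlr σ hσ => ?_⟩
  obtain ⟨c, hc⟩ := EGraph.eqv_self.1 hσ
  classical
  let τ : ℕ → G.Q := fun x => if hx : ∃ q, G.AcceptsG (σ x) q then hx.choose else c
  have hτ : ∀ {x q}, G.AcceptsG (σ x) q → G.AcceptsG (σ x) (τ x) := fun {x q} hq => by
    have hx : ∃ q, G.AcceptsG (σ x) q := ⟨q, hq⟩
    simp only [τ, dif_pos hx]
    exact hx.choose_spec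
  let m : EMatch R G := ⟨l, r, hlr, τ, c, hc.of_subst fun x _ q hq => G.det _ _ _ hq (hτ hq)⟩
  have key := (accepts_TRaut R G m (Subterm.refl _)).map_hom h
  have hroot : stateOf R G m (r.map τ) (Subterm.refl _) = .inl c := by
    have := hR _ hlr
    cases r with
    | var x => exact absurd rfl (this x)
    | node f ts => simp [Tm.map, stateOf, m]
  change Accepts _ _ (h.toFun (stateOf R G m (r.map τ) (Subterm.refl _))) at key
  have hmap : ((r.map τ).map (Sum.inl : G.Q → (TRaut R G).Q)).map h.toFun = r.map (g.toFun ∘ τ) :=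
    (congrArg _ (Tm.map_map τ _ r)).trans (Tm.map_map _ h.toFun r)
  rw [hroot] at key
  replace key : Accepts H.toAutomaton (r.map (g.toFun ∘ τ)) (g.toFun c) := hmap ▸ key
  refine ⟨g.toFun c, hc.map_hom g, key.subst fun x hx => ?_⟩
  obtain ⟨q, hq⟩ := hc.exists_var (R.var_cond _ hlr hx)
  exact (hτ hq).map_hom g

theorem le_of_closed {R : TRS F ar} {G H : EGraph F ar} (h : Closed R G.eqv H.eqv) :
    ALe (TRaut R G) H.toAutomaton := by
  obtain ⟨g⟩ := EGraph.le_of_eqv (fun a b => h.le (a := a) (b := b))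
  choose t ht using G.reach
  have hm : ∀ m : EMatch R G,
      Accepts H.toAutomaton ((m.rhs.map m.sub).map g.toFun) (g.toFun m.root) := fun m => by
    have h1 : G.AcceptsG (m.lhs.subst fun x => t (m.sub x)) m.root :=
      m.acc.subst fun x _ => ht _
    obtain ⟨q, h2, h3⟩ := h.rule m.mem _ (EGraph.eqv_self.2 ⟨_, h1⟩)
    obtain rfl := H.det _ _ _ h2 (h1.map_hom g)
    rw [Tm.map_map]
    exact h3.of_subst fun x _ q hq => H.det _ _ _ hq ((ht _).map_hom g)
  choose φ hφ using fun e : MExtra R G => Accepts.exists_subterm e.2 (hm e.1.1)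
  let k : G.Q ⊕ MExtra R G → H.Q := Sum.elim g.toFun φ
  have hk : ∀ (m : EMatch R G) (u : Tm F ar G.Q) (hu : Subterm u (m.rhs.map m.sub)),
      Accepts H.toAutomaton (u.map g.toFun) (k (stateOf R G m u hu)) := fun m u hu => by
    cases u with
    | var q => exact .var _
    | node f ts =>
      simp only [stateOf]
      split_ifs with hr
      · rw [hr]
        exact hm m
      · exact hφ ⟨(m, _), hu⟩
  refine ⟨⟨k, fun f qs q hq => ?_⟩⟩
  rcases hq with ⟨qs, q, hq, he⟩ | ⟨m, ts, hu, he⟩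
  · obtain ⟨rfl, rfl⟩ := Prod.mk.inj he
    exact g.map_trans _ _ _ hq
  · obtain ⟨rfl, rfl⟩ := Prod.mk.inj he
    have h1 := hk m _ hu
    generalize k (stateOf R G m (.node f ts) hu) = q at h1
    cases h1 with
    | @node _ _ qs' _ h2 h3 =>
      have : qs' = fun i => k (stateOf R G m (ts i) (Subterm.child i hu)) :=
        funext fun i => H.accepts_det (h2 i) (hk m _ _)
      rwa [this] at h3

theorem isICO_iff {R : TRS F ar} (hR : R.NodeRhs) {G H : EGraph F ar} :
    IsICO R G H ↔ Closed R G.eqv H.eqv ∧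
      ∀ E, IsPCR E → Closed R G.eqv E → ∀ a b, H.eqv a b → E a b := by
  constructor
  · rintro ⟨h1, h2⟩
    refine ⟨closed_of_le hR h1, fun E hE hcl a b hab => ?_⟩
    rw [← hE.eqv_egraph]
    refine (h2 hE.egraph (le_of_closed ?_)).eqv_mono hab
    exact ⟨fun h => hE.eqv_egraph.2 (hcl.le h), fun h σ h' => hE.eqv_egraph.2 (hcl.rule h σ h')⟩
  · rintro ⟨h1, h2⟩
    exact ⟨le_of_closed h1, fun K hK => EGraph.le_of_eqv fun a b =>
      h2 _ K.eqv_isPCR (closed_of_le hR hK) a b⟩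

theorem exists_isICO {R : TRS F ar} (hR : R.NodeRhs) (G : EGraph F ar) :
    ∃ H, IsICO R G H := by
  have hE : IsPCR fun a b => ∀ E, IsPCR E → Closed R G.eqv E → E a b :=
    { symm := fun h E hE hc => hE.symm (h E hE hc)
      trans := fun h h' E hE hc => hE.trans (h E hE hc) (h' E hE hc)
      congruent := fun f s t h h' E hE hc =>
        hE.congruent f s t (fun i => h i E hE hc) (h' E hE hc)
      reachable := fun f s h i E hE hc => hE.reachable f s (h E hE hc) i }
  refine ⟨hE.egraph, (isICO_iff hR).2 ⟨⟨fun h => ?_, fun hlr σ h => ?_⟩, fun E h1 h2 a b hab => ?_⟩⟩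
  · exact hE.eqv_egraph.2 fun E _ hc => hc.le h
  · exact hE.eqv_egraph.2 fun E _ hc => hc.rule hlr σ h
  · exact hE.eqv_egraph.1 hab E h1 h2

theorem exists_iterSeq {R : TRS F ar} (hR : R.NodeRhs) (G : EGraph F ar) :
    ∃ S, IterSeq R G S := by
  choose ico h using exists_isICO hR
  exact ⟨fun n => ico^[n] G, rfl, fun i => by
    simp only [Function.iterate_succ_apply']
    exact h _⟩

end EGraphTheory

/-! ## A compactness criterion for termination -/

section Compactness

variable {F : Type} {ar : F → ℕ}

/-- The union of the congruences of a sequence of E-graphs. -/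
def limEqv (S : ℕ → EGraph F ar) (a b : GTm F ar) : Prop := ∃ n, (S n).eqv a b

variable {R : TRS F ar} {G : EGraph F ar} {S : ℕ → EGraph F ar}

theorem IterSeq.eqv_mono (hR : R.NodeRhs) (hS : IterSeq R G S) {n m : ℕ} (h : n ≤ m)
    {a b : GTm F ar} (hab : (S n).eqv a b) : (S m).eqv a b := by
  induction m, h using Nat.le_induction with
  | base => exact hab
  | succ m _ ih => exact ((isICO_iff hR).1 (hS.2 m)).1.le ih

theorem IterSeq.limEqv_isPCR (hR : R.NodeRhs) (hS : IterSeq R G S) : IsPCR (limEqv S) where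
  symm := fun ⟨n, h⟩ => ⟨n, (S n).eqv_isPCR.symm h⟩
  trans := fun ⟨n, h⟩ ⟨m, h'⟩ => ⟨max n m, (S _).eqv_isPCR.trans
    (hS.eqv_mono hR (le_max_left _ _) h) (hS.eqv_mono hR (le_max_right _ _) h')⟩
  congruent := by
    rintro f s t h ⟨m, h'⟩
    choose n hn using h
    refine ⟨max m (Finset.univ.sup n), (S _).eqv_isPCR.congruent f s t (fun i => ?_)
      (hS.eqv_mono hR (le_max_left _ _) h')⟩
    exact hS.eqv_mono hR ((Finset.le_sup (Finset.mem_univ i)).trans (le_max_right _ _)) (hn i)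
  reachable := fun f s ⟨n, h⟩ i => ⟨n, (S n).eqv_isPCR.reachable f s h i⟩

theorem IterSeq.limEqv_closed (hR : R.NodeRhs) (hS : IterSeq R G S) :
    Closed R (limEqv S) (limEqv S) where
  le := id
  rule := fun hlr σ ⟨n, h⟩ => ⟨n + 1, ((isICO_iff hR).1 (hS.2 n)).1.rule hlr σ h⟩

/-- A sequence of iterates whose union has finitely many classes is eventually constant. -/
theorem IterSeq.eventually_iso [Finite F] (hR : R.NodeRhs) (hS : IterSeq R G S)
    {T : Set (GTm F ar)} (hT : T.Finite)
    (h : ∀ t, limEqv S t t → ∃ t' ∈ T, limEqv S t t') :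
    ∃ n, ∀ m, n ≤ m → (S m).Iso (S n) := by
  have hlim := hS.limEqv_isPCR hR
  have hfin : ∀ P : Set (GTm F ar × GTm F ar), P.Finite →
      ∃ n, ∀ p ∈ P, limEqv S p.1 p.2 → (S n).eqv p.1 p.2 := fun P hP => by
    classical
    refine ⟨hP.toFinset.sup fun p => if hp : limEqv S p.1 p.2 then hp.choose else 0,
      fun p hp hp' => ?_⟩
    have := Finset.le_sup (f := fun p : GTm F ar × GTm F ar =>
      if hp : limEqv S p.1 p.2 then hp.choose else 0) (hP.mem_toFinset.2 hp)
    simp only [dif_pos hp'] at this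
    exact hS.eqv_mono hR this hp'.choose_spec
  have : Finite T := hT
  let N : Set (GTm F ar) :=
    Set.range fun p : Σ f : F, Fin (ar f) → T => Tm.node p.1 fun i => (p.2 i).1
  have hN : N.Finite := Set.finite_range _
  obtain ⟨n, hn⟩ := hfin ((T ∪ N) ×ˢ T) ((hT.union hN).prod hT)
  have hrep : ∀ t, limEqv S t t → ∃ t' ∈ T, (S n).eqv t t' := fun t => by
    induction t with
    | var v => exact v.elim
    | node f ts ih =>
      intro ht
      have hts := hlim.reachable f ts ht
      choose s hsT hs using fun i => ih i (hts i)
      have h1 := hlim.congruent f ts s (fun i => ⟨n, hs i⟩) ht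
      obtain ⟨t', ht', h2⟩ := h _ (hlim.trans (hlim.symm h1) h1)
      have h3 := hn (.node f s, t') ⟨Or.inr ⟨⟨f, fun i => ⟨s i, hsT i⟩⟩, rfl⟩, ht'⟩ h2
      have hE := (S n).eqv_isPCR
      have h4 := hE.congruent f s ts (fun i => hE.symm (hs i)) (hE.trans h3 (hE.symm h3))
      exact ⟨t', ht', hE.trans (hE.symm h4) h3⟩
  refine ⟨n, fun m hm => EGraph.Le.iso (EGraph.le_of_eqv fun a b hab => ?_)
    (EGraph.le_of_eqv fun a b => hS.eqv_mono hR hm)⟩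
  have hab' : limEqv S a b := ⟨m, hab⟩
  obtain ⟨a', ha', ha⟩ := hrep a (hlim.trans hab' (hlim.symm hab'))
  obtain ⟨b', hb', hb⟩ := hrep b (hlim.trans (hlim.symm hab') hab')
  have hE := (S n).eqv_isPCR
  have h1 := hn (a', b') ⟨Or.inl ha', hb'⟩
    (hlim.trans (hlim.symm ⟨n, ha⟩) (hlim.trans hab' ⟨n, hb⟩))
  exact hE.trans ha (hE.trans h1 (hE.symm hb))

end Compactness

/-! ## Tree rewriting at the root, and its translation -/

/-- Binary trees with two kinds of leaves. -/
inductive Tree2 : Type where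
  | s : Tree2
  | a : Tree2
  | p : Tree2 → Tree2 → Tree2

/-- Patterns for binary trees. -/
inductive Pat : Type where
  | v : ℕ → Pat
  | s : Pat
  | a : Pat
  | p : Pat → Pat → Pat

/-- Instantiation of a pattern. -/
def Pat.inst (τ : ℕ → Tree2) : Pat → Tree2
  | .v x => τ x
  | .s => .s
  | .a => .a
  | .p l r => .p (l.inst τ) (r.inst τ)

/-- The variables of a pattern. -/
def Pat.vars : Pat → Set ℕ
  | .v x => {x}
  | .s => ∅
  | .a => ∅
  | .p l r => l.vars ∪ r.vars

/-- A tree as a pattern without variables. -/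
def Tree2.toPat : Tree2 → Pat
  | .s => .s
  | .a => .a
  | .p l r => .p l.toPat r.toPat

theorem Tree2.inst_toPat (τ : ℕ → Tree2) (t : Tree2) : t.toPat.inst τ = t := by
  induction t with
  | p l r hl hr => simp only [toPat, Pat.inst, hl, hr]
  | _ => rfl

theorem Tree2.vars_toPat (t : Tree2) : t.toPat.vars = ∅ := by
  induction t with
  | p l r hl hr => simp only [toPat, Pat.vars, hl, hr, Set.union_self]
  | _ => rfl

/-- One rewrite step at the root of a tree. -/
def RootStep (rs : List (Pat × Pat)) (t t' : Tree2) : Prop :=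
  ∃ r ∈ rs, ∃ τ, t = r.1.inst τ ∧ t' = r.2.inst τ

/-- The arities of the signature of the translation: two constants, a ternary pairing symbol and
two unary predicates. -/
def sysAr : Fin 5 → ℕ := ![0, 0, 3, 1, 1]

section Symbols

variable {V : Type}

/-- The constant marking live predicates. -/
def tS : Tm (Fin 5) sysAr V := .node 0 (![] : Fin 0 → _)
/-- The constant for the leaf `a`; it is identified with `tS` on success. -/
def tA : Tm (Fin 5) sysAr V := .node 1 (![] : Fin 0 → _)
/-- Pairing, with a flag as its first argument. -/
def tP (x y z : Tm (Fin 5) sysAr V) : Tm (Fin 5) sysAr V := .node 2 (![x, y, z] : Fin 3 → _)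
/-- The predicate of reachable trees. -/
def tR (x : Tm (Fin 5) sysAr V) : Tm (Fin 5) sysAr V := .node 3 (![x] : Fin 1 → _)
/-- The predicate of unary counters. -/
def tC (x : Tm (Fin 5) sysAr V) : Tm (Fin 5) sysAr V := .node 4 (![x] : Fin 1 → _)

variable {W : Type} (σ : V → Tm (Fin 5) sysAr W)

theorem subst_tS : (tS : Tm (Fin 5) sysAr V).subst σ = tS :=
  congrArg (Tm.node 0) (funext fun i : Fin 0 => i.elim0)

theorem subst_tA : (tA : Tm (Fin 5) sysAr V).subst σ = tA :=
  congrArg (Tm.node 1) (funext fun i : Fin 0 => i.elim0)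

theorem subst_tP (x y z : Tm (Fin 5) sysAr V) :
    (tP x y z).subst σ = tP (x.subst σ) (y.subst σ) (z.subst σ) :=
  congrArg (Tm.node 2) (funext fun i : Fin 3 => by fin_cases i <;> rfl)

theorem subst_tR (x : Tm (Fin 5) sysAr V) : (tR x).subst σ = tR (x.subst σ) :=
  congrArg (Tm.node 3) (funext fun i : Fin 1 => by fin_cases i; rfl)

theorem subst_tC (x : Tm (Fin 5) sysAr V) : (tC x).subst σ = tC (x.subst σ) :=
  congrArg (Tm.node 4) (funext fun i : Fin 1 => by fin_cases i; rfl)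

theorem subst_var (x : V) : (Tm.var x : Tm (Fin 5) sysAr V).subst σ = σ x := rfl

theorem vars_tS : (tS : Tm (Fin 5) sysAr V).vars = ∅ :=
  Set.iUnion_eq_empty.2 fun i : Fin 0 => i.elim0

theorem vars_tA : (tA : Tm (Fin 5) sysAr V).vars = ∅ :=
  Set.iUnion_eq_empty.2 fun i : Fin 0 => i.elim0

theorem vars_tP (x y z : Tm (Fin 5) sysAr V) :
    (tP x y z).vars = x.vars ∪ (y.vars ∪ z.vars) := by
  ext v
  change v ∈ (⋃ i : Fin 3, _) ↔ _
  simp [Fin.exists_fin_succ]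

theorem vars_tR (x : Tm (Fin 5) sysAr V) : (tR x).vars = x.vars := by
  ext v
  change v ∈ (⋃ i : Fin 1, _) ↔ _
  simp

theorem vars_tC (x : Tm (Fin 5) sysAr V) : (tC x).vars = x.vars := by
  ext v
  change v ∈ (⋃ i : Fin 1, _) ↔ _
  simp

end Symbols

/-- A pattern as a term. -/
def Pat.toTm : Pat → Tm (Fin 5) sysAr ℕ
  | .v x => .var x
  | .s => tS
  | .a => tA
  | .p l r => tP tS l.toTm r.toTm

/-- A tree as a ground term. -/
def Tree2.toG : Tree2 → GTm (Fin 5) sysAr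
  | .s => tS
  | .a => tA
  | .p l r => tP tS l.toG r.toG

theorem Pat.vars_toTm (l : Pat) : l.toTm.vars = l.vars := by
  induction l with
  | v x => rfl
  | s => exact vars_tS
  | a => exact vars_tA
  | p l r hl hr => simp only [toTm, vars_tP, vars_tS, vars, hl, hr, Set.empty_union]

theorem Pat.subst_toG (τ : ℕ → Tree2) (l : Pat) :
    l.toTm.subst (fun x => (τ x).toG) = (l.inst τ).toG := by
  induction l with
  | v x => rfl
  | s => exact subst_tS _
  | a => exact subst_tA _
  | p l r hl hr => simp only [toTm, subst_tP, subst_tS, inst, Tree2.toG, hl, hr]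

theorem Tree2.subst_toPat (σ : ℕ → GTm (Fin 5) sysAr) (t : Tree2) :
    t.toPat.toTm.subst σ = t.toG := by
  induction t with
  | s => exact subst_tS _
  | a => exact subst_tA _
  | p l r hl hr => simp only [toPat, Pat.toTm, subst_tP, subst_tS, Tree2.toG, hl, hr]

/-- The rules of the translation that do not depend on the starting tree. -/
def sysRules (rs : List (Pat × Pat)) (hp : Pat) :
    List (Tm (Fin 5) sysAr ℕ × Tm (Fin 5) sysAr ℕ) :=
  (tR hp.toTm, tA) :: (tP tA (.var 0) (.var 1), tA) :: (tS, tC tA) ::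
    (tC (.var 0), tC (tP tS tA (.var 0))) :: rs.map fun r => (tR r.1.toTm, tR r.2.toTm)

/-- The rules of the translation. -/
def allRules (rs : List (Pat × Pat)) (hp : Pat) (start : Tree2) :
    List (Tm (Fin 5) sysAr ℕ × Tm (Fin 5) sysAr ℕ) :=
  (tS, tR start.toPat.toTm) :: sysRules rs hp

/-- Translation of root rewriting, with a starting tree and a pattern of successful trees. -/
def sysInstance (rs : List (Pat × Pat)) (hp : Pat) (start : Tree2) : TRSInstance :=
  ⟨5, sysAr, allRules rs hp start⟩

theorem mem_allRules {rs : List (Pat × Pat)} {hp : Pat} {start : Tree2}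
    {p : Tm (Fin 5) sysAr ℕ × Tm (Fin 5) sysAr ℕ} : p ∈ allRules rs hp start ↔
      p = (tS, tR start.toPat.toTm) ∨ p = (tR hp.toTm, tA) ∨
      p = (tP tA (.var 0) (.var 1), tA) ∨ p = (tS, tC tA) ∨
      p = (tC (.var 0), tC (tP tS tA (.var 0))) ∨
      ∃ r ∈ rs, (tR r.1.toTm, tR r.2.toTm) = p := by
  simp only [allRules, sysRules, List.mem_cons, List.mem_map]

theorem allRules_rhs_ne_var {rs : List (Pat × Pat)} {hp : Pat} {start : Tree2}
    {p : Tm (Fin 5) sysAr ℕ × Tm (Fin 5) sysAr ℕ} (h : p ∈ allRules rs hp start) (x : ℕ) :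
    p.2 ≠ .var x := by
  rcases mem_allRules.1 h with rfl | rfl | rfl | rfl | rfl | ⟨r, _, rfl⟩ <;> exact nofun

theorem allRules_vars {rs : List (Pat × Pat)} (hrs : ∀ r ∈ rs, r.2.vars ⊆ r.1.vars) {hp : Pat}
    {start : Tree2} {p : Tm (Fin 5) sysAr ℕ × Tm (Fin 5) sysAr ℕ}
    (h : p ∈ allRules rs hp start) : p.2.vars ⊆ p.1.vars := by
  rcases mem_allRules.1 h with rfl | rfl | rfl | rfl | rfl | ⟨r, hr, rfl⟩
  · simp only [vars_tR, Pat.vars_toTm, Tree2.vars_toPat, Set.empty_subset]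
  · simp only [vars_tA, Set.empty_subset]
  · simp only [vars_tA, Set.empty_subset]
  · simp only [vars_tA, vars_tC, Set.empty_subset]
  · simp only [vars_tA, vars_tS, vars_tC, vars_tP, Set.empty_union, subset_rfl]
  · simpa only [vars_tR, Pat.vars_toTm] using hrs r hr

section System

variable {rs : List (Pat × Pat)} {hp : Pat} {start : Tree2}

/-- The consequences of the rules of the translation. -/
structure SysClosed (rs : List (Pat × Pat)) (hp : Pat) (start : Tree2)
    (E E' : GTm (Fin 5) sysAr → GTm (Fin 5) sysAr → Prop) : Prop where
  le : ∀ {x y}, E x y → E' x y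
  start : E tS tS → E' tS (tR start.toG)
  step : ∀ r ∈ rs, ∀ σ, E (tR (r.1.toTm.subst σ)) (tR (r.1.toTm.subst σ)) →
    E' (tR (r.1.toTm.subst σ)) (tR (r.2.toTm.subst σ))
  success : ∀ σ, E (tR (hp.toTm.subst σ)) (tR (hp.toTm.subst σ)) → E' (tR (hp.toTm.subst σ)) tA
  collapse : ∀ x y, E (tP tA x y) (tP tA x y) → E' (tP tA x y) tA
  count_zero : E tS tS → E' tS (tC tA)
  count_succ : ∀ x, E (tC x) (tC x) → E' (tC x) (tC (tP tS tA x))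

theorem closed_iff_sysClosed {R : TRS (Fin 5) sysAr}
    (hR : R.rules = {r | r ∈ allRules rs hp start})
    {E E' : GTm (Fin 5) sysAr → GTm (Fin 5) sysAr → Prop} :
    Closed R E E' ↔ SysClosed rs hp start E E' := by
  have hmem : ∀ {p}, p ∈ R.rules ↔ p ∈ allRules rs hp start := by simp [hR]
  simp only [mem_allRules] at hmem
  constructor
  · intro h
    refine ⟨h.le, fun h1 => ?_, fun r hr σ h1 => ?_, fun σ h1 => ?_, fun x y h1 => ?_,
      fun h1 => ?_, fun x h1 => ?_⟩
    · have := h.rule (hmem.2 (.inl rfl)) (fun _ => tS) (by rwa [subst_tS])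
      rwa [subst_tS, subst_tR, Tree2.subst_toPat] at this
    · have := h.rule (hmem.2 (.inr (.inr (.inr (.inr (.inr ⟨r, hr, rfl⟩)))))) σ
        (by rwa [subst_tR])
      rwa [subst_tR, subst_tR] at this
    · have := h.rule (hmem.2 (.inr (.inl rfl))) σ (by rwa [subst_tR])
      rwa [subst_tR, subst_tA] at this
    · have := h.rule (hmem.2 (.inr (.inr (.inl rfl)))) (fun n => if n = 0 then x else y)
        (by simpa [subst_tP, subst_tA, subst_var] using h1)
      simpa [subst_tP, subst_tA, subst_var] using this
    · have := h.rule (hmem.2 (.inr (.inr (.inr (.inl rfl))))) (fun _ => tS)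
        (by rwa [subst_tS])
      rwa [subst_tS, subst_tC, subst_tA] at this
    · have := h.rule (hmem.2 (.inr (.inr (.inr (.inr (.inl rfl)))))) (fun _ => x)
        (by rwa [subst_tC])
      rwa [subst_tC, subst_tC, subst_tP, subst_tS, subst_tA] at this
  · intro h
    refine ⟨h.le, fun {l r} hlr σ hσ => ?_⟩
    simp only [hmem, Prod.mk.injEq] at hlr
    rcases hlr with ⟨rfl, rfl⟩ | ⟨rfl, rfl⟩ | ⟨rfl, rfl⟩ | ⟨rfl, rfl⟩ | ⟨rfl, rfl⟩ |
      ⟨r, hr, rfl, rfl⟩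
    · rw [subst_tS] at hσ
      rw [subst_tS, subst_tR, Tree2.subst_toPat]
      exact h.start hσ
    · rw [subst_tR] at hσ
      rw [subst_tR, subst_tA]
      exact h.success σ hσ
    · rw [subst_tP, subst_tA] at hσ
      rw [subst_tP, subst_tA]
      exact h.collapse _ _ hσ
    · rw [subst_tS] at hσ
      rw [subst_tS, subst_tC, subst_tA]
      exact h.count_zero hσ
    · rw [subst_tC] at hσ
      rw [subst_tC, subst_tC, subst_tP, subst_tS, subst_tA]
      exact h.count_succ _ hσ
    · rw [subst_tR] at hσ
      rw [subst_tR, subst_tR]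
      exact h.step r hr σ hσ

/-! ### Success implies termination -/

variable {E : GTm (Fin 5) sysAr → GTm (Fin 5) sysAr → Prop}

theorem IsPCR.congr_tP (hE : IsPCR E) {x y z x' : GTm (Fin 5) sysAr} (h : E x x')
    (hd : E (tP x y z) (tP x y z)) : E (tP x y z) (tP x' y z) := by
  have h' := hE.reachable 2 _ hd
  refine hE.congruent 2 _ _ (fun i : Fin 3 => ?_) hd
  fin_cases i
  · exact h
  · exact h' (1 : Fin 3)
  · exact h' (2 : Fin 3)

theorem SysClosed.reach (hE : IsPCR E) (h : SysClosed rs hp start E E) (hS : E tS tS) {t : Tree2}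
    (ht : Relation.ReflTransGen (RootStep rs) start t) : E tS (tR t.toG) := by
  induction ht with
  | refl => exact h.start hS
  | tail _ hstep ih =>
    obtain ⟨r, hr, τ, rfl, rfl⟩ := hstep
    rw [← Pat.subst_toG] at ih ⊢
    exact hE.trans ih (h.step r hr _ (hE.trans (hE.symm ih) ih))

theorem SysClosed.tS_tA (hE : IsPCR E) (h : SysClosed rs hp start E E)
    (hsucc : ∃ τ, Relation.ReflTransGen (RootStep rs) start (hp.inst τ)) (hS : E tS tS) :
    E tS tA := by
  obtain ⟨τ, hτ⟩ := hsucc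
  have h1 := h.reach hE hS hτ
  rw [← Pat.subst_toG] at h1
  exact hE.trans h1 (h.success _ (hE.trans (hE.symm h1) h1))

theorem SysClosed.tP_tA (hE : IsPCR E) (h : SysClosed rs hp start E E)
    (hsucc : ∃ τ, Relation.ReflTransGen (RootStep rs) start (hp.inst τ)) {x y : GTm (Fin 5) sysAr}
    (hd : E (tP tS x y) (tP tS x y)) : E (tP tS x y) tA := by
  have h1 := h.tS_tA hE hsucc (hE.reachable 2 _ hd (0 : Fin 3))
  have h2 := hE.congr_tP h1 hd
  exact hE.trans h2 (h.collapse _ _ (hE.trans (hE.symm h2) h2))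

/-- Every subterm of `t` is related to an element of `T`. -/
def Covered (E : GTm (Fin 5) sysAr → GTm (Fin 5) sysAr → Prop) (T : Set (GTm (Fin 5) sysAr))
    (t : GTm (Fin 5) sysAr) : Prop :=
  ∀ u, Subterm u t → ∃ t' ∈ T, E u t'

variable {T : Set (GTm (Fin 5) sysAr)}

theorem covered_node {f : Fin 5} {ts : Fin (sysAr f) → GTm (Fin 5) sysAr} :
    Covered E T (.node f ts) ↔ (∃ t' ∈ T, E (.node f ts) t') ∧ ∀ i, Covered E T (ts i) := by
  constructor
  · exact fun h => ⟨h _ (.refl _), fun i u hu => h u (.node i hu)⟩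
  · rintro ⟨h1, h2⟩ u hu
    cases hu with
    | refl => exact h1
    | node i hi => exact h2 i u hi

theorem covered_tS (hT : tS ∈ T) (h : E tS tS) : Covered E T tS :=
  covered_node.2 ⟨⟨_, hT, h⟩, fun i : Fin 0 => i.elim0⟩

theorem covered_tA (hT : tA ∈ T) (h : E tA tA) : Covered E T tA :=
  covered_node.2 ⟨⟨_, hT, h⟩, fun i : Fin 0 => i.elim0⟩

theorem covered_tP {x y z : GTm (Fin 5) sysAr} : Covered E T (tP x y z) ↔
    (∃ t' ∈ T, E (tP x y z) t') ∧ Covered E T x ∧ Covered E T y ∧ Covered E T z := by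
  refine covered_node.trans (and_congr_right fun _ => ?_)
  change (∀ i : Fin 3, _) ↔ _
  simp only [Fin.forall_fin_succ]
  exact ⟨fun h => ⟨h.1, h.2.1, h.2.2.1⟩, fun h => ⟨h.1, h.2.1, h.2.2, fun i => i.elim0⟩⟩

theorem covered_tR {x : GTm (Fin 5) sysAr} : Covered E T (tR x) ↔
    (∃ t' ∈ T, E (tR x) t') ∧ Covered E T x := by
  refine covered_node.trans (and_congr_right fun _ => ?_)
  exact ⟨fun h => h (0 : Fin 1), fun h (i : Fin 1) => by fin_cases i; exact h⟩

theorem covered_tC {x : GTm (Fin 5) sysAr} : Covered E T (tC x) ↔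
    (∃ t' ∈ T, E (tC x) t') ∧ Covered E T x := by
  refine covered_node.trans (and_congr_right fun _ => ?_)
  exact ⟨fun h => h (0 : Fin 1), fun h (i : Fin 1) => by fin_cases i; exact h⟩

theorem IsPCR.restrict_covered (hE : IsPCR E) :
    IsPCR fun a b => E a b ∧ Covered E T a ∧ Covered E T b where
  symm := fun ⟨h, ha, hb⟩ => ⟨hE.symm h, hb, ha⟩
  trans := fun ⟨h, ha, _⟩ ⟨h', _, hc⟩ => ⟨hE.trans h h', ha, hc⟩
  congruent := by
    rintro f s t h ⟨h1, h2, -⟩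
    have h3 := hE.congruent f s t (fun i => (h i).1) h1
    obtain ⟨t', ht', h4⟩ := h2 _ (.refl _)
    exact ⟨h3, h2, covered_node.2 ⟨⟨t', ht', hE.trans (hE.symm h3) h4⟩, fun i => (h i).2.2⟩⟩
  reachable := fun f s ⟨h1, h2, _⟩ i =>
    ⟨hE.reachable f s h1 i, (covered_node.1 h2).2 i, (covered_node.1 h2).2 i⟩

theorem Pat.covered_subst (hE : IsPCR E) (h : SysClosed rs hp start E E)
    (hsucc : ∃ τ, Relation.ReflTransGen (RootStep rs) start (hp.inst τ))
    (hTS : tS ∈ T) (hTA : tA ∈ T) {σ : ℕ → GTm (Fin 5) sysAr} (r : Pat)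
    (hσ : ∀ x ∈ r.vars, Covered E T (σ x)) (hd : E (r.toTm.subst σ) (r.toTm.subst σ)) :
    Covered E T (r.toTm.subst σ) := by
  induction r with
  | v x => exact hσ x rfl
  | s =>
    simp only [toTm, subst_tS] at hd ⊢
    exact covered_tS hTS hd
  | a =>
    simp only [toTm, subst_tA] at hd ⊢
    exact covered_tA hTA hd
  | p l r hl hr =>
    simp only [toTm, subst_tP, subst_tS] at hd ⊢
    have hd' := hE.reachable 2 _ hd
    exact covered_tP.2 ⟨⟨_, hTA, h.tP_tA hE hsucc hd⟩, covered_tS hTS (hd' (0 : Fin 3)),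
      hl (fun x hx => hσ x (.inl hx)) (hd' (1 : Fin 3)),
      hr (fun x hx => hσ x (.inr hx)) (hd' (2 : Fin 3))⟩

theorem Tm.covered_of_subst {σ : ℕ → GTm (Fin 5) sysAr} {l : Tm (Fin 5) sysAr ℕ}
    (h : Covered E T (l.subst σ)) {x : ℕ} (hx : x ∈ l.vars) : Covered E T (σ x) := by
  induction l with
  | var v => cases hx; exact h
  | node f ts ih =>
    obtain ⟨i, hi⟩ := Set.mem_iUnion.1 hx
    exact ih i ((covered_node.1 h).2 i) hi

theorem SysClosed.covered (hrs : ∀ r ∈ rs, r.2.vars ⊆ r.1.vars) (hE : IsPCR E)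
    (h : SysClosed rs hp start E E)
    (hsucc : ∃ τ, Relation.ReflTransGen (RootStep rs) start (hp.inst τ))
    (hTS : tS ∈ T) (hTA : tA ∈ T) {E₀ : GTm (Fin 5) sysAr → GTm (Fin 5) sysAr → Prop}
    (hE₀ : ∀ {a b}, E₀ a b → E a b ∧ Covered E T a ∧ Covered E T b) :
    SysClosed rs hp start E₀ fun a b => E a b ∧ Covered E T a ∧ Covered E T b := by
  have hdom : ∀ {a b}, E a b → E b b := fun hab => hE.trans (hE.symm hab) hab
  have hrel : ∀ {a b}, E a b → Covered E T a → ∃ t' ∈ T, E b t' := fun hab ha => by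
    obtain ⟨t', ht', h1⟩ := ha _ (.refl _)
    exact ⟨t', ht', hE.trans (hE.symm hab) h1⟩
  refine ⟨hE₀, fun h1 => ?_, fun r hr σ h1 => ?_, fun σ h1 => ?_, fun x y h1 => ?_,
      fun h1 => ?_, fun x h1 => ?_⟩ <;> obtain ⟨h2, h3, -⟩ := hE₀ h1
  · have h4 := h.start h2
    refine ⟨h4, h3, covered_tR.2 ⟨hrel h4 h3, ?_⟩⟩
    have h5 := hE.reachable 3 _ (hdom h4) (0 : Fin 1)
    rw [← Tree2.subst_toPat fun _ => tS]
    refine Pat.covered_subst hE h hsucc hTS hTA _ (fun x hx => ?_) ?_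
    · rw [Tree2.vars_toPat] at hx
      exact hx.elim
    · rw [Tree2.subst_toPat]
      exact h5
  · have h4 := h.step r hr σ h2
    refine ⟨h4, h3, covered_tR.2 ⟨hrel h4 h3, ?_⟩⟩
    have h5 := hE.reachable 3 _ (hdom h4) (0 : Fin 1)
    refine Pat.covered_subst hE h hsucc hTS hTA _ (fun x hx => ?_) h5
    exact Tm.covered_of_subst (covered_tR.1 h3).2 (by rw [Pat.vars_toTm]; exact hrs r hr hx)
  · have h4 := h.success σ h2
    exact ⟨h4, h3, covered_tA hTA (hdom h4)⟩
  · have h4 := h.collapse x y h2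
    exact ⟨h4, h3, covered_tA hTA (hdom h4)⟩
  · have h4 := h.count_zero h2
    exact ⟨h4, h3, covered_tC.2 ⟨hrel h4 h3,
      covered_tA hTA (hE.reachable 4 _ (hdom h4) (0 : Fin 1))⟩⟩
  · have h4 := h.count_succ x h2
    have h5 := hE.reachable 4 _ (hdom h4) (0 : Fin 1)
    have h6 := hE.reachable 2 _ h5
    exact ⟨h4, h3, covered_tC.2 ⟨hrel h4 h3, covered_tP.2
      ⟨⟨_, hTA, h.tP_tA hE hsucc h5⟩, covered_tS hTS (h6 (0 : Fin 3)),
        covered_tA hTA (h6 (1 : Fin 3)), (covered_tC.1 h3).2⟩⟩⟩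

theorem EGraph.eqv_subterm {F : Type} {ar : F → ℕ} (G : EGraph F ar) {t u : GTm F ar}
    (hu : Subterm u t) (ht : G.eqv t t) : G.eqv u u := by
  induction hu with
  | refl => exact ht
  | node i _ ih => exact ih (G.eqv_isPCR.reachable _ _ ht i)

theorem eqSatTerminates_of_success (hrs : ∀ r ∈ rs, r.2.vars ⊆ r.1.vars)
    (hsucc : ∃ τ, Relation.ReflTransGen (RootStep rs) start (hp.inst τ)) {R : TRS (Fin 5) sysAr}
    (hR : R.rules = {r | r ∈ allRules rs hp start}) {G : EGraph (Fin 5) sysAr}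
    (hG : G.IsFinite) : EqSatTerminates R G := by
  have hR' : R.NodeRhs := fun p h => allRules_rhs_ne_var (by rwa [hR] at h)
  obtain ⟨S, hS⟩ := exists_iterSeq hR' G
  have hE := hS.limEqv_isPCR hR'
  have hcl := (closed_iff_sysClosed hR).1 (hS.limEqv_closed hR')
  choose t ht using G.reach
  let T : Set (GTm (Fin 5) sysAr) := Set.range t ∪ {tS, tA}
  have hTS : tS ∈ T := .inr (.inl rfl)
  have hTA : tA ∈ T := .inr (.inr rfl)
  have : Finite G.Q := hG.1
  have key : ∀ n a b, (S n).eqv a b → limEqv S a b ∧ Covered (limEqv S) T a ∧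
      Covered (limEqv S) T b := fun n => by
    induction n with
    | zero =>
      intro a b hab
      have hcov : ∀ c, (S 0).eqv c c → Covered (limEqv S) T c := fun c hc u hu => by
        obtain ⟨q, hq, -⟩ := (hS.1 ▸ (S 0).eqv_subterm hu hc : G.eqv u u)
        exact ⟨t q, .inl ⟨q, rfl⟩, 0, hS.1.symm ▸ ⟨q, hq, ht q⟩⟩
      have hp := (S 0).eqv_isPCR
      exact ⟨⟨0, hab⟩, hcov a (hp.trans hab (hp.symm hab)), hcov b (hp.trans (hp.symm hab) hab)⟩
    | succ n ih =>
      refine ((isICO_iff hR').1 (hS.2 n)).2 _ hE.restrict_covered ?_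
      exact (closed_iff_sysClosed hR).2 (hcl.covered hrs hE hsucc hTS hTA fun h => ih _ _ h)
  refine ⟨S, hS, hS.eventually_iso hR' (T := T) ?_ fun c ⟨n, hc⟩ => ?_⟩
  · exact (Set.finite_range t).union (Set.toFinite _)
  · exact (key n c c hc).2.1 _ (.refl _)

end System

/-! ### Termination implies success -/

section Models

variable {F : Type} {ar : F → ℕ} {X : Type}

/-- Evaluation of ground terms in an algebra. -/
def Tm.fold (alg : (f : F) → (Fin (ar f) → X) → X) : GTm F ar → X
  | .var v => v.elim
  | .node f ts => alg f fun i => (ts i).fold alg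

theorem isPCR_fold {alg : (f : F) → (Fin (ar f) → Option X) → Option X}
    (hs : ∀ f xs x, alg f xs = some x → ∀ i, ∃ y, xs i = some y) :
    IsPCR fun a b : GTm F ar => ∃ x, a.fold alg = some x ∧ b.fold alg = some x where
  symm := fun ⟨x, h, h'⟩ => ⟨x, h', h⟩
  trans := fun ⟨x, h1, h2⟩ ⟨y, h3, h4⟩ => ⟨x, h1, by rw [h4, ← h3, h2]⟩
  congruent := by
    rintro f s t h ⟨x, hx, -⟩
    refine ⟨x, hx, ?_⟩
    rw [← hx]
    simp only [Tm.fold]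
    congr 1
    funext i
    obtain ⟨y, h1, h2⟩ := h i
    rw [h1, h2]
  reachable := by
    rintro f s ⟨x, hx, -⟩ i
    obtain ⟨y, hy⟩ := hs _ _ _ hx i
    exact ⟨y, hy, hy⟩

end Models

/-- Unary numerals as trees. -/
def Tree2.num : ℕ → Tree2
  | 0 => .a
  | n + 1 => .p .a (num n)

theorem Tree2.num_injective : Function.Injective Tree2.num := by
  intro m n h
  induction m generalizing n with
  | zero =>
    cases n with
    | zero => rfl
    | succ n => simp [num] at h
  | succ m ih =>
    cases n with
    | zero => simp [num] at h
    | succ n =>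
      simp only [num, Tree2.p.injEq, true_and] at h
      rw [ih h]

open Classical in
/-- The partial algebra of trees in which `C` is defined up to `n`. -/
noncomputable def treeAlg (P : Tree2 → Prop) (n : ℕ) :
    (f : Fin 5) → (Fin (sysAr f) → Option Tree2) → Option Tree2
  | 0, _ => some .s
  | 1, _ => some .a
  | 2, xs => if xs (0 : Fin 3) = some .s then
      (xs (1 : Fin 3)).bind fun u => (xs (2 : Fin 3)).map (Tree2.p u) else none
  | 3, xs => (xs (0 : Fin 1)).bind fun u => if P u then some .s else none
  | 4, xs => (xs (0 : Fin 1)).bind fun u => if ∃ j ≤ n, u = Tree2.num j then some .s else none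

/-- The value of a ground term in the partial algebra of trees. -/
noncomputable def treeVal (P : Tree2 → Prop) (n : ℕ) (t : GTm (Fin 5) sysAr) : Option Tree2 :=
  t.fold (treeAlg P n)

/-- The partial congruence of terms with the same value. -/
def treeEqv (P : Tree2 → Prop) (n : ℕ) (t t' : GTm (Fin 5) sysAr) : Prop :=
  ∃ u, treeVal P n t = some u ∧ treeVal P n t' = some u

section TreeVal

variable {P : Tree2 → Prop} {n : ℕ}

theorem treeAlg_strict : ∀ f xs x, treeAlg P n f xs = some x → ∀ i, ∃ y, xs i = some y := by
  intro f xs x h i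
  match f, xs, i, h with
  | 0, xs, i, _ => exact Fin.elim0 i
  | 1, xs, i, _ => exact Fin.elim0 i
  | 2, xs, i, h =>
    have hi : ∀ i : Fin 3, ∃ y, xs i = some y := by
      simp only [treeAlg, Option.ite_none_right_eq_some, Option.bind_eq_some_iff,
        Option.map_eq_some_iff] at h
      obtain ⟨h0, u, h1, v, h2, -⟩ := h
      intro i
      fin_cases i
      exacts [⟨_, h0⟩, ⟨_, h1⟩, ⟨_, h2⟩]
    exact hi i
  | 3, xs, i, h =>
    have hi : ∀ i : Fin 1, ∃ y, xs i = some y := by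
      simp only [treeAlg, Option.bind_eq_some_iff] at h
      obtain ⟨u, h0, -⟩ := h
      intro i
      fin_cases i
      exact ⟨_, h0⟩
    exact hi i
  | 4, xs, i, h =>
    have hi : ∀ i : Fin 1, ∃ y, xs i = some y := by
      simp only [treeAlg, Option.bind_eq_some_iff] at h
      obtain ⟨u, h0, -⟩ := h
      intro i
      fin_cases i
      exact ⟨_, h0⟩
    exact hi i

theorem treeEqv_isPCR : IsPCR (treeEqv P n) := isPCR_fold treeAlg_strict

theorem treeVal_tS : treeVal P n tS = some .s := rfl

theorem treeVal_tA : treeVal P n tA = some .a := rfl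

theorem treeVal_tP {x y z : GTm (Fin 5) sysAr} {t : Tree2} : treeVal P n (tP x y z) = some t ↔
    treeVal P n x = some .s ∧ ∃ u v, treeVal P n y = some u ∧ treeVal P n z = some v ∧
      t = .p u v := by
  change treeAlg P n 2 (fun i : Fin 3 => treeVal P n ((![x, y, z] : Fin 3 → _) i)) = _ ↔ _
  simp only [treeAlg, Option.ite_none_right_eq_some, Option.bind_eq_some_iff,
        Option.map_eq_some_iff]
  constructor
  · rintro ⟨h, u, h1, v, h2, rfl⟩
    exact ⟨h, u, v, h1, h2, rfl⟩
  · rintro ⟨h, u, v, h1, h2, rfl⟩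
    exact ⟨h, u, h1, v, h2, rfl⟩

theorem treeVal_tR {x : GTm (Fin 5) sysAr} {t : Tree2} : treeVal P n (tR x) = some t ↔
    t = .s ∧ ∃ u, treeVal P n x = some u ∧ P u := by
  change treeAlg P n 3 (fun i : Fin 1 => treeVal P n ((![x] : Fin 1 → _) i)) = _ ↔ _
  simp only [treeAlg, Option.ite_none_right_eq_some, Option.bind_eq_some_iff, Option.some.injEq]
  constructor
  · rintro ⟨u, h, h1, rfl⟩
    exact ⟨rfl, u, h, h1⟩
  · rintro ⟨rfl, u, h, h1⟩
    exact ⟨u, h, h1, rfl⟩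

theorem treeVal_tC {x : GTm (Fin 5) sysAr} {t : Tree2} : treeVal P n (tC x) = some t ↔
    t = .s ∧ ∃ j ≤ n, treeVal P n x = some (.num j) := by
  change treeAlg P n 4 (fun i : Fin 1 => treeVal P n ((![x] : Fin 1 → _) i)) = _ ↔ _
  simp only [treeAlg, Option.ite_none_right_eq_some, Option.bind_eq_some_iff, Option.some.injEq]
  constructor
  · rintro ⟨u, h, ⟨j, hj, rfl⟩, rfl⟩
    exact ⟨rfl, j, hj, h⟩
  · rintro ⟨rfl, j, hj, h⟩
    exact ⟨_, h, ⟨j, hj, rfl⟩, rfl⟩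

theorem treeVal_mono {m : ℕ} (h : n ≤ m) {t : GTm (Fin 5) sysAr} {u : Tree2}
    (ht : treeVal P n t = some u) : treeVal P m t = some u := by
  induction t generalizing u with
  | var v => exact v.elim
  | node f ts ih =>
    match f, ts, ih, ht with
    | 0, ts, _, ht => exact ht
    | 1, ts, _, ht => exact ht
    | 2, ts, ih, ht =>
      obtain ⟨h0, v, w, h1, h2, rfl⟩ := treeVal_tP
        (x := ts (0 : Fin 3)) (y := ts (1 : Fin 3)) (z := ts (2 : Fin 3)) |>.1 ht
      exact (treeVal_tP (x := ts (0 : Fin 3)) (y := ts (1 : Fin 3)) (z := ts (2 : Fin 3))).2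
        ⟨ih (0 : Fin 3) h0, v, w, ih (1 : Fin 3) h1, ih (2 : Fin 3) h2, rfl⟩
    | 3, ts, ih, ht =>
      obtain ⟨rfl, v, h0, h1⟩ := treeVal_tR (x := ts (0 : Fin 1)) |>.1 ht
      exact (treeVal_tR (x := ts (0 : Fin 1))).2 ⟨rfl, v, ih (0 : Fin 1) h0, h1⟩
    | 4, ts, ih, ht =>
      obtain ⟨rfl, j, hj, h0⟩ := treeVal_tC (x := ts (0 : Fin 1)) |>.1 ht
      exact (treeVal_tC (x := ts (0 : Fin 1))).2 ⟨rfl, j, hj.trans h, ih (0 : Fin 1) h0⟩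

theorem treeVal_toG (t : Tree2) : treeVal P n t.toG = some t := by
  induction t with
  | s => rfl
  | a => rfl
  | p l r hl hr => exact treeVal_tP.2 ⟨rfl, l, r, hl, hr, rfl⟩

theorem treeVal_subst {σ : ℕ → GTm (Fin 5) sysAr} {l : Pat} {τ : ℕ → Tree2}
    (h : ∀ x ∈ l.vars, treeVal P n (σ x) = some (τ x)) :
    treeVal P n (l.toTm.subst σ) = some (l.inst τ) := by
  induction l with
  | v x => exact h x rfl
  | s => simp only [Pat.toTm, subst_tS, treeVal_tS, Pat.inst]
  | a => simp only [Pat.toTm, subst_tA, treeVal_tA, Pat.inst]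
  | p l r hl hr =>
    simp only [Pat.toTm, subst_tP, subst_tS]
    exact treeVal_tP.2 ⟨rfl, _, _, hl fun x hx => h x (.inl hx), hr fun x hx => h x (.inr hx), rfl⟩

theorem exists_treeVal_subst {σ : ℕ → GTm (Fin 5) sysAr} {l : Pat} {t : Tree2}
    (h : treeVal P n (l.toTm.subst σ) = some t) :
    ∃ τ : ℕ → Tree2, (∀ x ∈ l.vars, treeVal P n (σ x) = some (τ x)) ∧ t = l.inst τ := by
  have key : ∀ x ∈ l.vars, treeVal P n (σ x) = some ((treeVal P n (σ x)).getD .s) := by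
    induction l generalizing t with
    | v x =>
      rintro y rfl
      change treeVal P n (σ y) = some t at h
      rw [h, Option.getD_some]
    | s => exact fun x hx => hx.elim
    | a => exact fun x hx => hx.elim
    | p l r hl hr =>
      simp only [Pat.toTm, subst_tP, subst_tS] at h
      obtain ⟨-, u, v, h1, h2, -⟩ := treeVal_tP.1 h
      rintro x (hx | hx)
      · exact hl h1 x hx
      · exact hr h2 x hx
  refine ⟨_, key, ?_⟩
  rw [treeVal_subst key] at h
  exact (Option.some.inj h).symm

end TreeVal

/-- The E-graph with the single term `tS`. -/
def oneEGraph : EGraph (Fin 5) sysAr where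
  Q := Unit
  trans f := {_p | f = 0}
  det := fun _ _ _ _ _ => rfl
  reach := fun _ => ⟨tS, acceptsG_node.2 ⟨fun i : Fin 0 => i.elim0, fun i : Fin 0 => i.elim0, rfl⟩⟩

theorem oneEGraph_isFinite : oneEGraph.IsFinite :=
  ⟨inferInstanceAs (Finite Unit), fun f => by
    have : Finite oneEGraph.Q := inferInstanceAs (Finite Unit)
    exact Set.toFinite _⟩

theorem oneEGraph_accepts {t : GTm (Fin 5) sysAr} {q : oneEGraph.Q}
    (h : oneEGraph.AcceptsG t q) : t = tS := by
  cases t with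
  | var v => exact v.elim
  | node f ts =>
    obtain ⟨qs, -, h2⟩ := acceptsG_node.1 h
    obtain rfl : f = 0 := h2
    exact congrArg (Tm.node 0) (funext fun i : Fin 0 => i.elim0)

section Termination

variable {rs : List (Pat × Pat)} {hp : Pat} {start : Tree2}

theorem treeEqv_sysClosed (hrs : ∀ r ∈ rs, r.2.vars ⊆ r.1.vars)
    (hfail : ¬ ∃ τ, Relation.ReflTransGen (RootStep rs) start (hp.inst τ)) (n : ℕ) :
    SysClosed rs hp start (treeEqv (Relation.ReflTransGen (RootStep rs) start) n)
      (treeEqv (Relation.ReflTransGen (RootStep rs) start) (n + 1)) where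
  le := fun ⟨u, h1, h2⟩ => ⟨u, treeVal_mono n.le_succ h1, treeVal_mono n.le_succ h2⟩
  start := fun _ => ⟨.s, rfl, treeVal_tR.2 ⟨rfl, _, treeVal_toG _, .refl⟩⟩
  step := by
    rintro r hr σ ⟨u, h, -⟩
    obtain ⟨rfl, v, h1, h2⟩ := treeVal_tR.1 h
    obtain ⟨τ, hτ, rfl⟩ := exists_treeVal_subst h1
    exact ⟨.s, treeVal_mono n.le_succ h, treeVal_tR.2 ⟨rfl, _,
      treeVal_subst fun x hx => treeVal_mono n.le_succ (hτ x (hrs r hr hx)),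
      h2.tail ⟨r, hr, τ, rfl, rfl⟩⟩⟩
  success := by
    rintro σ ⟨u, h, -⟩
    obtain ⟨rfl, v, h1, h2⟩ := treeVal_tR.1 h
    obtain ⟨τ, hτ, rfl⟩ := exists_treeVal_subst h1
    exact (hfail ⟨τ, h2⟩).elim
  collapse := by
    rintro x y ⟨u, h, -⟩
    have h1 := (treeVal_tP.1 h).1
    simp [treeVal_tA] at h1
  count_zero := fun _ => ⟨.s, rfl, treeVal_tC.2 ⟨rfl, 0, Nat.zero_le _, rfl⟩⟩
  count_succ := by
    rintro x ⟨u, h, -⟩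
    obtain ⟨rfl, j, hj, h1⟩ := treeVal_tC.1 h
    exact ⟨.s, treeVal_mono n.le_succ h, treeVal_tC.2 ⟨rfl, j + 1, Nat.succ_le_succ hj,
      treeVal_tP.2 ⟨rfl, _, _, rfl, treeVal_mono n.le_succ h1, rfl⟩⟩⟩

theorem success_of_eqSatTerminates (hrs : ∀ r ∈ rs, r.2.vars ⊆ r.1.vars) {R : TRS (Fin 5) sysAr}
    (hR : R.rules = {r | r ∈ allRules rs hp start}) (h : EqSatTerminates R oneEGraph) :
    ∃ τ, Relation.ReflTransGen (RootStep rs) start (hp.inst τ) := by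
  by_contra hfail
  have hR' : R.NodeRhs := fun p h => allRules_rhs_ne_var (by rwa [hR] at h)
  obtain ⟨S, hS, N, hN⟩ := h
  have hsub : ∀ n a b, (S n).eqv a b →
      treeEqv (Relation.ReflTransGen (RootStep rs) start) n a b := fun n => by
    induction n with
    | zero =>
      rintro a b hab
      rw [hS.1] at hab
      obtain ⟨q, ha, hb⟩ := hab
      rw [oneEGraph_accepts ha, oneEGraph_accepts hb]
      exact ⟨.s, rfl, rfl⟩
    | succ n ih =>
      refine ((isICO_iff hR').1 (hS.2 n)).2 _ treeEqv_isPCR ((closed_iff_sysClosed hR).2 ?_)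
      have hcl := treeEqv_sysClosed hrs hfail n
      exact ⟨fun h => hcl.le (ih _ _ h), fun h => hcl.start (ih _ _ h),
        fun r hr σ h => hcl.step r hr σ (ih _ _ h), fun σ h => hcl.success σ (ih _ _ h),
        fun x y h => hcl.collapse x y (ih _ _ h), fun h => hcl.count_zero (ih _ _ h),
        fun x h => hcl.count_succ x (ih _ _ h)⟩
  have hdom : ∀ k, (S (k + 1)).eqv (tC (Tree2.num k).toG) (tC (Tree2.num k).toG) := fun k => by
    have hcl := (closed_iff_sysClosed hR).1 ((isICO_iff hR').1 (hS.2 k)).1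
    have hp := (S (k + 1)).eqv_isPCR
    have hright : ∀ {a b}, (S (k + 1)).eqv a b → (S (k + 1)).eqv b b := fun h =>
      hp.trans (hp.symm h) h
    induction k with
    | zero =>
      refine hright (hcl.count_zero ?_)
      rw [hS.1]
      exact ⟨(), acceptsG_node.2 ⟨fun i : Fin 0 => i.elim0, fun i : Fin 0 => i.elim0, rfl⟩,
        acceptsG_node.2 ⟨fun i : Fin 0 => i.elim0, fun i : Fin 0 => i.elim0, rfl⟩⟩
    | succ k ih =>
      refine hright (hcl.count_succ _ (ih ?_ ?_ ?_))
      · exact (closed_iff_sysClosed hR).1 ((isICO_iff hR').1 (hS.2 k)).1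
      · exact (S (k + 1)).eqv_isPCR
      · exact fun h => (S (k + 1)).eqv_isPCR.trans ((S (k + 1)).eqv_isPCR.symm h) h
  obtain ⟨φ, -⟩ := hN (N + 2) (by omega)
  obtain ⟨u, hu, -⟩ := hsub _ _ _ (EGraph.Le.eqv_mono ⟨φ⟩ (hdom (N + 1)))
  obtain ⟨-, j, hj, h1⟩ := treeVal_tC.1 hu
  rw [treeVal_toG] at h1
  have := Tree2.num_injective (Option.some.inj h1)
  omega

theorem allEGraphTerminates_sysInstance (hrs : ∀ r ∈ rs, r.2.vars ⊆ r.1.vars) :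
    AllEGraphTerminates (sysInstance rs hp start) ↔
      ∃ τ, Relation.ReflTransGen (RootStep rs) start (hp.inst τ) := by
  constructor
  · rintro ⟨R, hR, h⟩
    exact success_of_eqSatTerminates hrs hR (h oneEGraph oneEGraph_isFinite)
  · intro h
    exact ⟨⟨{r | r ∈ allRules rs hp start}, List.finite_toSet _, fun r hr => allRules_vars hrs hr⟩,
      rfl, fun G hG => eqSatTerminates_of_success hrs h rfl hG⟩

end Termination

/-! ## Simulating computable functions by root rewriting -/

section Simulation

open Turing.ToPartrec

/-- A tagged tree. -/
def Tree2.tag (n : ℕ) (t : Tree2) : Tree2 := .p (.num n) t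

/-- A tagged pattern. -/
def Pat.tag (n : ℕ) (l : Pat) : Pat := .p (Tree2.num n).toPat l

theorem Pat.inst_tag (τ : ℕ → Tree2) (n : ℕ) (l : Pat) : (l.tag n).inst τ = (l.inst τ).tag n := by
  simp only [tag, inst, Tree2.inst_toPat, Tree2.tag]

theorem Pat.vars_tag (n : ℕ) (l : Pat) : (l.tag n).vars = l.vars := by
  simp only [tag, vars, Tree2.vars_toPat, Set.empty_union]

theorem Tree2.tag_inj {m n : ℕ} {t u : Tree2} : t.tag m = u.tag n ↔ m = n ∧ t = u := by
  simp only [tag, p.injEq, num_injective.eq_iff]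

/-- The tree of a list of numbers. -/
def listTree : List ℕ → Tree2
  | [] => .s
  | n :: v => .p (.num n) (listTree v)

/-- The tree of a code. -/
def codeTree : Code → Tree2
  | .zero' => .tag 0 .s
  | .succ => .tag 1 .s
  | .tail => .tag 2 .s
  | .cons f g => .tag 3 (.p (codeTree f) (codeTree g))
  | .comp f g => .tag 4 (.p (codeTree f) (codeTree g))
  | .case f g => .tag 5 (.p (codeTree f) (codeTree g))
  | .fix f => .tag 6 (codeTree f)

/-- The tree of a continuation. -/
def contTree : Cont → Tree2
  | .halt => .tag 0 .s
  | .cons₁ f v k => .tag 1 (.p (codeTree f) (.p (listTree v) (contTree k)))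
  | .cons₂ v k => .tag 2 (.p (listTree v) (contTree k))
  | .comp f k => .tag 3 (.p (codeTree f) (contTree k))
  | .fix f k => .tag 4 (.p (codeTree f) (contTree k))

/-- The configuration evaluating `c` in the continuation `k` on the input `v`. -/
def normTree (c : Code) (k : Cont) (v : List ℕ) : Tree2 :=
  .p .a (.p (codeTree c) (.p (contTree k) (listTree v)))

/-- The configuration returning `v` to the continuation `k`. -/
def retTree (k : Cont) (v : List ℕ) : Tree2 := .p .s (.p (contTree k) (listTree v))

/-- The tree of a configuration. -/
def cfgTree : Cfg → Tree2
  | .halt v => retTree .halt v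
  | .ret k v => retTree k v

/-- The pattern of configurations evaluating a code. -/
def Pat.norm (c k v : Pat) : Pat := .p .a (.p c (.p k v))

/-- The pattern of configurations returning a value. -/
def Pat.ret (k v : Pat) : Pat := .p .s (.p k v)

/-- The rules evaluating a code. -/
def normRules : List (Pat × Pat) :=
  [(.norm (.tag 0 .s) (.v 0) (.v 1), .ret (.v 0) (.p .a (.v 1))),
   (.norm (.tag 1 .s) (.v 0) .s, .ret (.v 0) (.p (.p .a .a) .s)),
   (.norm (.tag 1 .s) (.v 0) (.p (.v 1) (.v 2)), .ret (.v 0) (.p (.p .a (.v 1)) .s)),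
   (.norm (.tag 2 .s) (.v 0) .s, .ret (.v 0) .s),
   (.norm (.tag 2 .s) (.v 0) (.p (.v 1) (.v 2)), .ret (.v 0) (.v 2)),
   (.norm (.tag 3 (.p (.v 0) (.v 1))) (.v 2) (.v 3),
      .norm (.v 0) (.tag 1 (.p (.v 1) (.p (.v 3) (.v 2)))) (.v 3)),
   (.norm (.tag 4 (.p (.v 0) (.v 1))) (.v 2) (.v 3),
      .norm (.v 1) (.tag 3 (.p (.v 0) (.v 2))) (.v 3)),
   (.norm (.tag 5 (.p (.v 0) (.v 1))) (.v 2) .s, .norm (.v 0) (.v 2) .s),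
   (.norm (.tag 5 (.p (.v 0) (.v 1))) (.v 2) (.p .a (.v 3)), .norm (.v 0) (.v 2) (.v 3)),
   (.norm (.tag 5 (.p (.v 0) (.v 1))) (.v 2) (.p (.p .a (.v 3)) (.v 4)),
      .norm (.v 1) (.v 2) (.p (.v 3) (.v 4))),
   (.norm (.tag 6 (.v 0)) (.v 1) (.v 2), .norm (.v 0) (.tag 4 (.p (.v 0) (.v 1))) (.v 2))]

/-- The rules returning a value. -/
def retRules : List (Pat × Pat) :=
  [(.ret (.tag 1 (.p (.v 0) (.p (.v 1) (.v 2)))) (.v 3),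
      .norm (.v 0) (.tag 2 (.p (.v 3) (.v 2))) (.v 1)),
   (.ret (.tag 2 (.p .s (.v 0))) (.v 1), .ret (.v 0) (.p .a (.v 1))),
   (.ret (.tag 2 (.p (.p (.v 2) (.v 3)) (.v 0))) (.v 1), .ret (.v 0) (.p (.v 2) (.v 1))),
   (.ret (.tag 3 (.p (.v 0) (.v 1))) (.v 2), .norm (.v 0) (.v 1) (.v 2)),
   (.ret (.tag 4 (.p (.v 0) (.v 1))) .s, .ret (.v 1) .s),
   (.ret (.tag 4 (.p (.v 0) (.v 1))) (.p .a (.v 2)), .ret (.v 1) (.v 2)),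
   (.ret (.tag 4 (.p (.v 0) (.v 1))) (.p (.p .a (.v 3)) (.v 2)),
      .norm (.v 0) (.tag 4 (.p (.v 0) (.v 1))) (.v 2))]

/-- The rules simulating the evaluation of codes. -/
def simRules : List (Pat × Pat) := normRules ++ retRules

/-- The pattern of halting configurations. -/
def haltPat : Pat := .ret (.tag 0 .s) (.v 0)

theorem simRules_vars : ∀ r ∈ simRules, r.2.vars ⊆ r.1.vars := by
  simp only [simRules, normRules, retRules, List.cons_append, List.nil_append, List.forall_mem_cons,
    Pat.norm, Pat.ret, Pat.vars, Pat.vars_tag, Set.subset_def, Set.mem_union, Set.mem_singleton_iff,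
    Set.mem_empty_iff_false]
  refine ⟨?_, ?_, ?_, ?_, ?_, ?_, ?_, ?_, ?_, ?_, ?_, ?_, ?_, ?_, ?_, ?_, ?_, ?_, by simp⟩ <;> tauto

/-- Reachability by the simulating rules. -/
abbrev SimReach : Tree2 → Tree2 → Prop := Relation.ReflTransGen (RootStep simRules)

theorem simReach_of_mem {l r : Pat} (h : (l, r) ∈ simRules) (τ : ℕ → Tree2) {t u v : Tree2}
    (ht : t = l.inst τ) (hu : r.inst τ = u) (huv : SimReach u v) : SimReach t v :=
  .head ⟨_, h, τ, ht, hu.symm⟩ huv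

theorem normTree_reach (c : Code) (k : Cont) (v : List ℕ) :
    SimReach (normTree c k v) (cfgTree (stepNormal c k v)) := by
  have hr : ∀ i, ∀ h : i < simRules.length, simRules[i] ∈ simRules := fun _ _ => List.getElem_mem _
  induction c generalizing k v with
  | zero' =>
    exact simReach_of_mem (hr 0 (by decide)) (fun i => [contTree k, listTree v].getD i .s)
      rfl rfl .refl
  | succ =>
    cases v with
    | nil =>
      exact simReach_of_mem (hr 1 (by decide)) (fun i => [contTree k].getD i .s) rfl rfl .refl
    | cons x v =>
      exact simReach_of_mem (hr 2 (by decide))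
        (fun i => [contTree k, .num x, listTree v].getD i .s) rfl rfl .refl
  | tail =>
    cases v with
    | nil =>
      exact simReach_of_mem (hr 3 (by decide)) (fun i => [contTree k].getD i .s) rfl rfl .refl
    | cons x v =>
      exact simReach_of_mem (hr 4 (by decide))
        (fun i => [contTree k, .num x, listTree v].getD i .s) rfl rfl .refl
  | cons f g ihf ihg =>
    exact simReach_of_mem (hr 5 (by decide))
      (fun i => [codeTree f, codeTree g, contTree k, listTree v].getD i .s) rfl rfl
      (ihf (.cons₁ g v k) v)
  | comp f g ihf ihg =>
    exact simReach_of_mem (hr 6 (by decide))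
      (fun i => [codeTree f, codeTree g, contTree k, listTree v].getD i .s) rfl rfl
      (ihg (.comp f k) v)
  | case f g ihf ihg =>
    rcases v with _ | ⟨_ | x, v⟩
    · exact simReach_of_mem (hr 7 (by decide))
        (fun i => [codeTree f, codeTree g, contTree k].getD i .s) rfl rfl (ihf k [])
    · exact simReach_of_mem (hr 8 (by decide))
        (fun i => [codeTree f, codeTree g, contTree k, listTree v].getD i .s) rfl rfl (ihf k v)
    · exact simReach_of_mem (hr 9 (by decide))
        (fun i => [codeTree f, codeTree g, contTree k, .num x, listTree v].getD i .s) rfl rfl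
        (ihg k (x :: v))
  | fix f ih =>
    exact simReach_of_mem (hr 10 (by decide))
      (fun i => [codeTree f, contTree k, listTree v].getD i .s) rfl rfl (ih (.fix f k) v)

theorem retTree_reach (k : Cont) (v : List ℕ) :
    SimReach (retTree k v) (cfgTree (stepRet k v)) := by
  have hr : ∀ i, ∀ h : i < simRules.length, simRules[i] ∈ simRules := fun _ _ => List.getElem_mem _
  induction k generalizing v with
  | halt => exact .refl
  | cons₁ f w k ih =>
    exact simReach_of_mem (hr 11 (by decide))
      (fun i => [codeTree f, listTree w, contTree k, listTree v].getD i .s) rfl rfl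
      (normTree_reach f (.cons₂ v k) w)
  | cons₂ w k ih =>
    cases w with
    | nil =>
      exact simReach_of_mem (hr 12 (by decide))
        (fun i => [contTree k, listTree v].getD i .s) rfl rfl (ih (0 :: v))
    | cons x w =>
      exact simReach_of_mem (hr 13 (by decide))
        (fun i => [contTree k, listTree v, .num x, listTree w].getD i .s) rfl rfl (ih (x :: v))
  | comp f k ih =>
    exact simReach_of_mem (hr 14 (by decide))
      (fun i => [codeTree f, contTree k, listTree v].getD i .s) rfl rfl (normTree_reach f k v)
  | fix f k ih =>
    rcases v with _ | ⟨_ | x, v⟩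
    · exact simReach_of_mem (hr 15 (by decide))
        (fun i => [codeTree f, contTree k].getD i .s) rfl rfl (ih [])
    · exact simReach_of_mem (hr 16 (by decide))
        (fun i => [codeTree f, contTree k, listTree v].getD i .s) rfl rfl (ih v)
    · exact simReach_of_mem (hr 17 (by decide))
        (fun i => [codeTree f, contTree k, listTree v, .num x].getD i .s) rfl rfl
        (normTree_reach f (.fix f k) v)

theorem cfgTree_reach {x y : Cfg} (h : StateTransition.Reaches step x y) :
    SimReach (cfgTree x) (cfgTree y) := by
  induction h with
  | refl => exact .refl
  | @tail y z _ h ih =>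
    refine ih.trans ?_
    cases y with
    | halt v => simp [step] at h
    | ret k v =>
      simp only [step, Option.mem_def, Option.some.injEq] at h
      rw [← h]
      exact retTree_reach k v

/-- The trees of configurations with a given result of evaluation. -/
def HasEval (o : Part Cfg) (t : Tree2) : Prop :=
  (∃ c k v, t = normTree c k v ∧ StateTransition.eval step (stepNormal c k v) = o) ∨
    ∃ k v, t = retTree k v ∧ StateTransition.eval step (stepRet k v) = o

theorem eval_ret (k : Cont) (v : List ℕ) :
    StateTransition.eval step (.ret k v) = StateTransition.eval step (stepRet k v) :=
  StateTransition.reaches_eval (.single rfl)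

theorem hasEval_norm {o : Part Cfg} {c : Code} {k : Cont} {v : List ℕ}
    (h : StateTransition.eval step (stepNormal c k v) = o) : HasEval o (normTree c k v) :=
  .inl ⟨c, k, v, rfl, h⟩

theorem hasEval_ret {o : Part Cfg} {k : Cont} {v : List ℕ}
    (h : StateTransition.eval step (stepRet k v) = o) : HasEval o (retTree k v) :=
  .inr ⟨k, v, rfl, h⟩


theorem listTree_eq_s {v : List ℕ} : listTree v = .s ↔ v = [] := by
  cases v <;> simp [listTree]

theorem listTree_eq_p {v : List ℕ} {x y : Tree2} :
    listTree v = .p x y ↔ ∃ n w, v = n :: w ∧ .num n = x ∧ listTree w = y := by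
  cases v <;> simp [listTree]

theorem num_eq_a {n : ℕ} : Tree2.num n = .a ↔ n = 0 := by
  cases n <;> simp [Tree2.num]

theorem num_eq_p {n : ℕ} {x : Tree2} :
    Tree2.num n = .p .a x ↔ ∃ m, n = m + 1 ∧ .num m = x := by
  cases n <;> simp [Tree2.num]

theorem normTree_eq_inst {c : Code} {k : Cont} {v : List ℕ} {C K V : Pat} {τ : ℕ → Tree2} :
    normTree c k v = (Pat.norm C K V).inst τ ↔
      codeTree c = C.inst τ ∧ contTree k = K.inst τ ∧ listTree v = V.inst τ := by
  simp only [normTree, Pat.norm, Pat.inst, Tree2.p.injEq, true_and]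

theorem retTree_eq_inst {k : Cont} {v : List ℕ} {K V : Pat} {τ : ℕ → Tree2} :
    retTree k v = (Pat.ret K V).inst τ ↔ contTree k = K.inst τ ∧ listTree v = V.inst τ := by
  simp only [retTree, Pat.ret, Pat.inst, Tree2.p.injEq, true_and]

theorem normTree_ne_ret {c : Code} {k : Cont} {v : List ℕ} {K V : Pat} {τ : ℕ → Tree2} :
    normTree c k v ≠ (Pat.ret K V).inst τ := by
  simp [normTree, Pat.ret, Pat.inst]

theorem retTree_ne_norm {k : Cont} {v : List ℕ} {C K V : Pat} {τ : ℕ → Tree2} :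
    retTree k v ≠ (Pat.norm C K V).inst τ := by
  simp [retTree, Pat.norm, Pat.inst]

theorem hasEval_normRules {o : Part Cfg} {c : Code} {k : Cont} {v : List ℕ} {r : Pat × Pat}
    {τ : ℕ → Tree2} (h : StateTransition.eval step (stepNormal c k v) = o) (hr : r ∈ normRules)
    (h1 : normTree c k v = r.1.inst τ) : HasEval o (r.2.inst τ) := by
  simp only [normRules, List.mem_cons, List.not_mem_nil, or_false] at hr
  rcases hr with rfl | rfl | rfl | rfl | rfl | rfl | rfl | rfl | rfl | rfl | rfl <;>
    simp only [normTree_eq_inst, Pat.inst, Pat.inst_tag, listTree_eq_s, listTree_eq_p] at h1 <;>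
    obtain ⟨hc, hk, hv⟩ := h1 <;>
    cases c <;>
    simp only [codeTree, Tree2.tag_inj, Nat.reduceEqDiff, false_and, reduceCtorEq, and_false,
      true_and, Tree2.p.injEq] at hc <;>
    simp only [Pat.norm, Pat.ret, Pat.inst, Pat.inst_tag]
  · rw [← hk, ← hv]
    exact hasEval_ret (v := 0 :: v) ((eval_ret _ _).symm.trans h)
  · subst hv
    rw [← hk]
    exact hasEval_ret (v := [1]) ((eval_ret _ _).symm.trans h)
  · obtain ⟨n, w, rfl, hn, hw⟩ := hv
    rw [← hk, ← hn]
    exact hasEval_ret (v := [n + 1]) ((eval_ret _ _).symm.trans h)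
  · subst hv
    rw [← hk]
    exact hasEval_ret (v := []) ((eval_ret _ _).symm.trans h)
  · obtain ⟨n, w, rfl, hn, hw⟩ := hv
    rw [← hk, ← hw]
    exact hasEval_ret (v := w) ((eval_ret _ _).symm.trans h)
  · obtain ⟨hf, hg⟩ := hc
    rw [← hf, ← hg, ← hk, ← hv]
    exact hasEval_norm (k := .cons₁ _ v k) h
  · obtain ⟨hf, hg⟩ := hc
    rw [← hf, ← hg, ← hk, ← hv]
    exact hasEval_norm (k := .comp _ k) h
  · obtain ⟨hf, hg⟩ := hc
    subst hv
    rw [← hf, ← hk]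
    exact hasEval_norm (v := []) h
  · obtain ⟨hf, hg⟩ := hc
    obtain ⟨n, w, rfl, hn, hw⟩ := hv
    obtain rfl := num_eq_a.1 hn
    rw [← hf, ← hk, ← hw]
    exact hasEval_norm h
  · obtain ⟨hf, hg⟩ := hc
    obtain ⟨n, w, rfl, hn, hw⟩ := hv
    obtain ⟨m, rfl, hm⟩ := num_eq_p.1 hn
    rw [← hg, ← hk, ← hw, ← hm]
    exact hasEval_norm (v := m :: w) h
  · rw [← hc, ← hk, ← hv]
    exact hasEval_norm (k := .fix _ k) h

theorem hasEval_retRules {o : Part Cfg} {k : Cont} {v : List ℕ} {r : Pat × Pat}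
    {τ : ℕ → Tree2} (h : StateTransition.eval step (stepRet k v) = o) (hr : r ∈ retRules)
    (h1 : retTree k v = r.1.inst τ) : HasEval o (r.2.inst τ) := by
  simp only [retRules, List.mem_cons, List.not_mem_nil, or_false] at hr
  rcases hr with rfl | rfl | rfl | rfl | rfl | rfl | rfl <;>
    simp only [retTree_eq_inst, Pat.inst, Pat.inst_tag, listTree_eq_s, listTree_eq_p] at h1 <;>
    obtain ⟨hk, hv⟩ := h1 <;>
    cases k <;>
    simp only [contTree, Tree2.tag_inj, Nat.reduceEqDiff, false_and, reduceCtorEq, and_false,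
      true_and, Tree2.p.injEq, listTree_eq_s, listTree_eq_p] at hk <;>
    simp only [Pat.norm, Pat.ret, Pat.inst, Pat.inst_tag]
  · obtain ⟨hf, hw, hk⟩ := hk
    rw [← hf, ← hw, ← hk, ← hv]
    exact hasEval_norm (k := .cons₂ v _) h
  · obtain ⟨rfl, hk⟩ := hk
    rw [← hk, ← hv]
    exact hasEval_ret (v := 0 :: v) h
  · obtain ⟨⟨n, w, rfl, hn, hw⟩, hk⟩ := hk
    rw [← hn, ← hk, ← hv]
    exact hasEval_ret (v := n :: v) h
  · obtain ⟨hf, hk⟩ := hk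
    rw [← hf, ← hk, ← hv]
    exact hasEval_norm h
  · obtain ⟨hf, hk⟩ := hk
    subst hv
    rw [← hk]
    exact hasEval_ret (v := []) h
  · obtain ⟨hf, hk⟩ := hk
    obtain ⟨n, w, rfl, hn, hw⟩ := hv
    obtain rfl := num_eq_a.1 hn
    rw [← hk, ← hw]
    exact hasEval_ret h
  · obtain ⟨hf, hk⟩ := hk
    obtain ⟨n, w, rfl, hn, hw⟩ := hv
    obtain ⟨m, rfl, hm⟩ := num_eq_p.1 hn
    rw [← hf, ← hk, ← hw]
    exact hasEval_norm (k := .fix _ _) h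

theorem hasEval_step {o : Part Cfg} {t t' : Tree2} (ht : HasEval o t)
    (h : RootStep simRules t t') : HasEval o t' := by
  obtain ⟨r, hr, τ, h1, rfl⟩ := h
  have hnorm : ∀ r ∈ normRules, ∃ C K V, r.1 = Pat.norm C K V := by
    simp [normRules]
  have hret : ∀ r ∈ retRules, ∃ K V, r.1 = Pat.ret K V := by
    simp [retRules]
  rcases List.mem_append.1 hr with hr | hr <;> rcases ht with ⟨c, k, v, rfl, h⟩ | ⟨k, v, rfl, h⟩
  · exact hasEval_normRules h hr h1
  · obtain ⟨C, K, V, hC⟩ := hnorm r hr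
    rw [hC] at h1
    exact (retTree_ne_norm h1).elim
  · obtain ⟨K, V, hC⟩ := hret r hr
    rw [hC] at h1
    exact (normTree_ne_ret h1).elim
  · exact hasEval_retRules h hr h1

/-- The simulating rules reach a halting configuration exactly if the evaluation terminates. -/
theorem simReach_halt_iff (c : Code) (v : List ℕ) :
    (∃ τ, SimReach (normTree c .halt v) (haltPat.inst τ)) ↔ (c.eval v).Dom := by
  have hdom : (StateTransition.eval step (stepNormal c .halt v)).Dom ↔ (c.eval v).Dom := by
    rw [stepNormal_eval]
    exact Iff.rfl
  rw [← hdom]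
  constructor
  · rintro ⟨τ, hτ⟩
    have key : ∀ t, SimReach (normTree c .halt v) t →
        HasEval (StateTransition.eval step (stepNormal c .halt v)) t := fun t ht => by
      induction ht with
      | refl => exact hasEval_norm rfl
      | tail _ h ih => exact hasEval_step ih h
    rcases key _ hτ with ⟨c', k, w, h1, -⟩ | ⟨k, w, h1, h2⟩
    · exact (normTree_ne_ret h1.symm).elim
    · obtain ⟨hk, -⟩ := retTree_eq_inst.1 h1.symm
      rw [Pat.inst_tag] at hk
      cases k <;> simp only [contTree, Tree2.tag_inj, false_and, reduceCtorEq] at hk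
      rw [← h2]
      exact Part.dom_iff_mem.2 ⟨.halt w, StateTransition.mem_eval.2 ⟨.refl, rfl⟩⟩
  · intro h
    obtain ⟨y, hy⟩ := Part.dom_iff_mem.1 h
    obtain ⟨h1, h2⟩ := StateTransition.mem_eval.1 hy
    cases y with
    | ret k w => simp [step] at h2
    | halt w =>
      exact ⟨fun _ => listTree w, (normTree_reach c .halt v).trans (cfgTree_reach h1)⟩

end Simulation

/-! ## Computability of the translation -/

section WTypeCode

open Encodable

variable {A : Type} {B : A → Type} [∀ a, Fintype (B a)] [∀ a, Encodable (B a)] [Encodable A]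

theorem WType.exists_encodable_depth :
    ∃ h : ∀ n, Encodable {t : WType B // t.depth ≤ n},
      (∀ t : WType B, encode t = Nat.pair t.depth (@encode _ (h t.depth) ⟨t, le_rfl⟩)) ∧
      ∀ n a (f : B a → WType B) (hf : (WType.mk a f).depth ≤ n + 1),
        @encode _ (h (n + 1)) ⟨⟨a, f⟩, hf⟩ = Nat.pair (encode a)
          (@encode _ (@fintypeArrowOfEncodable _ _ _ _ (h n)) fun i : B a =>
            (⟨f i, Nat.le_of_lt_succ (lt_of_lt_of_le (WType.depth_lt_depth_mk a f i) hf)⟩ :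
              {t : WType B // t.depth ≤ n})) := by
  refine ⟨?_, ?_, ?_⟩
  rotate_left
  · intro t
    exact rfl
  · intro n a f hf
    rfl

/-- The code of a node from the codes of its children. -/
def nodeCode (a : A) (c : B a → ℕ) : ℕ :=
  Nat.pair (encode a) (encode (List.ofFn fun i =>
    Nat.pair i (c ((fintypeEquivFin (α := B a)).symm i))))

theorem encode_list_congr {α β : Type} [Encodable α] [Encodable β] {l : List α} {l' : List β}
    (h : l.map encode = l'.map encode) : encode l = encode l' := by
  induction l generalizing l' with
  | nil => cases l' with
    | nil => rfl
    | cons => simp at h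
  | cons x l ih => cases l' with
    | nil => simp at h
    | cons y l' =>
      simp only [List.map_cons, List.cons.injEq] at h
      rw [encode_list_cons, encode_list_cons, h.1, ih h.2]

theorem encode_fintypeArrow {α β : Type} [Fintype α] [Encodable α] [Encodable β] (f : α → β) :
    @encode _ fintypeArrowOfEncodable f =
      encode (List.ofFn fun i =>
        Nat.pair i (encode (f ((fintypeEquivFin (α := α)).symm i)))) := by
  have h1 : @encode _ fintypeArrowOfEncodable f =
      @encode _ finArrow fun i =>
        (⟨i, f ((fintypeEquivFin (α := α)).symm i)⟩ : Σ _ : Fin (Fintype.card α), β) := by rfl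
  have h2 : ∀ {n m : ℕ} (g : Fin n → Σ _ : Fin m, β),
      @encode _ finArrow g = encode (List.Vector.ofFn g).toList := fun g => by rfl
  rw [h1, h2, List.Vector.toList_ofFn]
  refine encode_list_congr ?_
  simp only [List.map_ofFn, Function.comp_def, encode_sigma_val]
  rfl

theorem WType.exists_code : ∃ code : WType B → ℕ,
    (∀ t : WType B, encode t = Nat.pair t.depth (code t)) ∧
    ∀ a f, code ⟨a, f⟩ = nodeCode a fun i => code (f i) := by
  obtain ⟨h, h1, h2⟩ := WType.exists_encodable_depth (B := B)
  have key : ∀ (t : WType B) n (hn : t.depth ≤ n),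
      @encode _ (h n) ⟨t, hn⟩ = @encode _ (h t.depth) ⟨t, le_rfl⟩ := fun t => by
    induction t with
    | mk a f ih =>
      have : ∀ n (hn : (WType.mk a f).depth ≤ n), @encode _ (h n) ⟨⟨a, f⟩, hn⟩ =
          nodeCode a fun i => @encode _ (h (f i).depth) ⟨f i, le_rfl⟩ := by
        rintro (_ | n) hn
        · exact absurd hn (by simp [WType.depth])
        · rw [h2, @encode_fintypeArrow _ _ _ _ (h n)]
          simp only [ih]
          rfl
      intro n hn
      rw [this, this]
  refine ⟨fun t => @encode _ (h t.depth) ⟨t, le_rfl⟩, h1, fun a f => ?_⟩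
  have hd : (WType.mk a f).depth ≤ (WType.mk a f).depth + 1 := Nat.le_succ _
  beta_reduce
  rw [← key _ _ hd, h2, @encode_fintypeArrow _ _ _ _ (h _)]
  simp only [key]
  rfl

/-- The numerical part of the standard encoding of a tree, without its depth. -/
noncomputable def WType.code (t : WType B) : ℕ := WType.exists_code.choose t

theorem WType.encode_eq (t : WType B) : encode t = Nat.pair t.depth t.code :=
  WType.exists_code.choose_spec.1 t

theorem WType.code_mk (a : A) (f : B a → WType B) :
    (WType.mk a f).code = nodeCode a fun i => (f i).code :=
  WType.exists_code.choose_spec.2 a f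

theorem primrec_nodeCode {α : Type} [Primcodable α] (a : A) {c : B a → α → ℕ}
    (hc : ∀ i, Primrec (c i)) : Primrec fun x => nodeCode a fun i => c i x :=
  Primrec₂.natPair.comp (Primrec.const _) (Primrec.encode.comp (Primrec.list_ofFn fun _ =>
    Primrec₂.natPair.comp (Primrec.const _) (hc _)))

theorem primrec_finset_sup {α ι : Type} [Primcodable α] (s : Finset ι) {d : ι → α → ℕ}
    (hd : ∀ i, Primrec (d i)) : Primrec fun x => s.sup fun i => d i x := by
  classical
  induction s using Finset.induction_on with
  | empty => exact Primrec.const _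
  | insert i s _ ih =>
    simp only [Finset.sup_insert]
    exact Primrec.nat_max.comp (hd i) ih

/-- A family of trees with primitive recursive codes. -/
def PrimTree {α : Type} [Primcodable α] (t : α → WType B) : Prop :=
  Primrec (fun x => (t x).depth) ∧ Primrec fun x => (t x).code

variable {α : Type} [Primcodable α]

theorem PrimTree.const (t : WType B) : PrimTree fun _ : α => t :=
  ⟨Primrec.const _, Primrec.const _⟩

theorem PrimTree.comp {α' : Type} [Primcodable α'] {t : α → WType B} (h : PrimTree t)
    {f : α' → α} (hf : Primrec f) : PrimTree fun x => t (f x) :=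
  ⟨h.1.comp hf, h.2.comp hf⟩

theorem PrimTree.mk (a : A) {f : α → B a → WType B} (h : ∀ i, PrimTree fun x => f x i) :
    PrimTree fun x => WType.mk a (f x) := by
  constructor
  · simp only [WType.depth]
    exact Primrec.succ.comp (primrec_finset_sup _ fun i => (h i).1)
  · simp only [WType.code_mk]
    exact primrec_nodeCode a fun i => (h i).2

theorem PrimTree.iterate (a : A) (f : WType B → B a → WType B)
    (hf : ∀ i, (∃ t, ∀ x, f x i = t) ∨ ∀ x, f x i = x) {t : ℕ → WType B}
    (ht : ∀ n, t (n + 1) = WType.mk a (f (t n))) : PrimTree t := by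
  have hstep : ∀ (m : WType B → ℕ) (i), ∃ g : ℕ → ℕ, Primrec g ∧ ∀ x, m (f x i) = g (m x) :=
    fun m i => by
      rcases hf i with ⟨u, hu⟩ | hu
      · exact ⟨fun _ => m u, Primrec.const _, fun x => by rw [hu]⟩
      · exact ⟨id, Primrec.id, fun x => by rw [hu, id]⟩
  have hrec : ∀ (m : WType B → ℕ) (g : ℕ → ℕ), Primrec g → (∀ n, m (t (n + 1)) = g (m (t n))) →
      Primrec fun n => m (t n) := fun m g hg h => by
    refine (Primrec.nat_rec₁ (m (t 0)) (hg.comp Primrec.snd).to₂).of_eq fun n => ?_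
    induction n with
    | zero => rfl
    | succ n ih => rw [h, ← ih]
  choose gd hgd hd using hstep WType.depth
  choose gc hgc hc using hstep WType.code
  refine ⟨hrec _ _ (Primrec.succ.comp (primrec_finset_sup Finset.univ hgd)) fun n => ?_,
    hrec _ _ (primrec_nodeCode a hgc) fun n => ?_⟩
  · rw [ht, WType.depth]
    simp only [hd]
  · rw [ht, WType.code_mk]
    simp only [hc]

theorem PrimTree.primrec_encode {t : α → WType B} (h : PrimTree t) :
    Primrec fun x => encode (t x) := by
  simp only [WType.encode_eq]
  exact Primrec₂.natPair.comp h.1 h.2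

end WTypeCode

section Computability

/-- A family of binary trees whose translations have primitive recursive codes. -/
def PrimTree2 {α : Type} [Primcodable α] (t : α → Tree2) : Prop :=
  PrimTree fun x => (t x).toPat.toTm.toW

theorem PrimTree2.const {α : Type} [Primcodable α] (t : Tree2) : PrimTree2 fun _ : α => t :=
  PrimTree.const _

theorem PrimTree2.p {α : Type} [Primcodable α] {l r : α → Tree2} (hl : PrimTree2 l)
    (hr : PrimTree2 r) : PrimTree2 fun x => .p (l x) (r x) := by
  refine PrimTree.mk (B := TmShape 5 sysAr ℕ) (.inl 2)
    (f := fun x (i : Fin 3) => (![tS, (l x).toPat.toTm, (r x).toPat.toTm] i).toW) fun i => ?_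
  change Fin 3 at i
  fin_cases i
  · exact PrimTree.const _
  · exact hl
  · exact hr

theorem PrimTree2.num : PrimTree2 Tree2.num := by
  refine PrimTree.iterate (B := TmShape 5 sysAr ℕ) (.inl 2)
    (fun w (i : Fin 3) => ![Tm.toW tS, Tm.toW tA, w] i) (fun i => ?_) fun n => ?_
  · change Fin 3 at i
    fin_cases i
    · exact .inl ⟨_, fun _ => rfl⟩
    · exact .inl ⟨_, fun _ => rfl⟩
    · exact .inr fun _ => rfl
  · refine congrArg (WType.mk (β := TmShape 5 sysAr ℕ) (.inl 2)) (funext fun i => ?_)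
    change Fin 3 at i
    fin_cases i <;> rfl

theorem primrec_encode_sysInstance {α : Type} [Primcodable α] (rs : List (Pat × Pat)) (hp : Pat)
    {start : α → Tree2} (h : PrimTree2 start) :
    Primrec fun x => Encodable.encode (sysInstance rs hp (start x)) := by
  have hR : Primrec fun x => Encodable.encode (tR (start x).toPat.toTm) :=
    PrimTree.primrec_encode (t := fun x => (tR (start x).toPat.toTm).toW) <|
      PrimTree.mk (B := TmShape 5 sysAr ℕ) (.inl 3)
        (f := fun x (i : Fin 1) => (![(start x).toPat.toTm] i).toW) fun i => by
          change Fin 1 at i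
          fin_cases i
          exact h
  have heq : ∀ x, Encodable.encode (sysInstance rs hp (start x)) =
      Nat.pair 5 (Nat.pair (Encodable.encode sysAr) (Nat.succ (Nat.pair
        (Nat.pair (Encodable.encode (tS : Tm (Fin 5) sysAr ℕ))
          (Encodable.encode (tR (start x).toPat.toTm)))
        (Encodable.encode (sysRules rs hp))))) := fun x => by
    rw [sysInstance, Encodable.encode_sigma_val, Encodable.encode_sigma_val, allRules,
      Encodable.encode_list_cons, Encodable.encode_prod_val]
    rfl
  simp only [heq]
  exact Primrec₂.natPair.comp (Primrec.const _) <| Primrec₂.natPair.comp (Primrec.const _) <|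
    Primrec.succ.comp <| Primrec₂.natPair.comp
      (Primrec₂.natPair.comp (Primrec.const _) hR) (Primrec.const _)

theorem exists_code_of_rePred {p : ℕ → Prop} (hp : REPred p) :
    ∃ c : Turing.ToPartrec.Code, ∀ n, (c.eval [n]).Dom ↔ p n := by
  have hf : Partrec fun n => (Part.assert (p n) fun _ => Part.some ()).map fun _ => 0 :=
    Partrec.map hp (Computable.const 0).to₂
  obtain ⟨c, hc⟩ := Turing.ToPartrec.Code.exists_code (Nat.Partrec'.part_iff₁.2 hf)
  refine ⟨c, fun n => ?_⟩
  have h := hc (n ::ᵥ List.Vector.nil)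
  rw [show (n ::ᵥ List.Vector.nil).1 = [n] from rfl] at h
  rw [h]
  simp [Part.assert, List.Vector.head_cons]

theorem REPred.decode {α : Type} [Primcodable α] {p : α → Prop} (hp : REPred p) :
    REPred fun n : ℕ => ∃ x, Encodable.decode n = some x ∧ p x := by
  have h : Partrec fun n : ℕ => (Part.ofOption (Encodable.decode (α := α) n)).bind fun x =>
      Part.assert (p x) fun _ => Part.some () :=
    Partrec.bind Computable.decode.ofOption (Partrec.comp hp Computable.snd).to₂
  refine h.dom_re.of_eq fun n => ?_
  simp [Part.dom_iff_mem, Part.mem_assert_iff]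

theorem exists_reduction_of_rePred {α : Type} [Primcodable α] {p : α → Prop} (hp : REPred p) :
    ∃ g : α → TRSInstance, Computable (fun x => Encodable.encode (g x)) ∧
      ∀ x, p x ↔ AllEGraphTerminates (g x) := by
  obtain ⟨c, hc⟩ := exists_code_of_rePred hp.decode
  refine ⟨fun x => sysInstance simRules haltPat (normTree c .halt [Encodable.encode x]),
    (primrec_encode_sysInstance _ _ ?_).to_comp, fun x => ?_⟩
  · exact (PrimTree2.const _).p <| (PrimTree2.const _).p <| (PrimTree2.const _).p <|
      PrimTree2.p (PrimTree.comp PrimTree2.num Primrec.encode) (PrimTree2.const _)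
  · rw [allEGraphTerminates_sysInstance simRules_vars, simReach_halt_iff, hc]
    simp

theorem PrimrecPred.rePred_exists {α β : Type} [Primcodable α] [Primcodable β]
    {p : α × β → Prop} (hp : PrimrecPred p) : REPred fun x => ∃ y, p (x, y) := by
  classical
  have hf : Primrec₂ fun (x : α) (n : ℕ) =>
      (Encodable.decode (α := β) n).bind fun y => if p (x, y) then some () else none := by
    refine Primrec.option_bind (Primrec.decode.comp Primrec.snd) ?_
    refine Primrec.ite ?_ (Primrec.const _) (Primrec.const _)
    exact hp.comp (Primrec.pair (Primrec.fst.comp Primrec.fst) Primrec.snd)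
  refine (Partrec.rfindOpt hf.to_comp).dom_re.of_eq fun x => ?_
  rw [Nat.rfindOpt_dom]
  constructor
  · rintro ⟨n, u, h⟩
    obtain ⟨y, -, hy⟩ := Option.mem_bind_iff.1 h
    by_contra hn
    simp [not_exists.1 hn y] at hy
  · rintro ⟨y, hy⟩
    exact ⟨Encodable.encode y, (), by simp [hy]⟩

theorem rePred_pcpSolvable : REPred PCPSolvable := by
  have hword : ∀ f : List ℕ × List ℕ → List ℕ, Primrec f →
      Primrec fun x : PCPInstance × List ℕ =>
        (x.2.map fun i => f (x.1.getD i ([], []))).flatten := fun f hf => by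
    refine Primrec.list_flatten.comp (Primrec.list_map Primrec.snd ?_)
    exact hf.comp ((Primrec.list_getD _).comp (Primrec.fst.comp Primrec.fst) Primrec.snd)
  have hlt : PrimrecPred fun x : PCPInstance × List ℕ => ∀ i ∈ x.2, i < x.1.length := by
    have : PrimrecRel fun (i : ℕ) (x : PCPInstance × List ℕ) => i < x.1.length :=
      Primrec.nat_lt.comp Primrec.fst (Primrec.list_length.comp (Primrec.fst.comp Primrec.snd))
    exact this.forall_mem_list.comp Primrec.snd Primrec.id
  have hdec : PrimrecPred fun x : PCPInstance × List ℕ => x.2 ≠ [] ∧ (∀ i ∈ x.2, i < x.1.length) ∧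
      (x.2.map fun i => (x.1.getD i ([], [])).1).flatten =
        (x.2.map fun i => (x.1.getD i ([], [])).2).flatten :=
    (Primrec.eq.comp Primrec.snd (Primrec.const [])).not.and <| hlt.and <|
      Primrec.eq.comp (hword _ Primrec.fst) (hword _ Primrec.snd)
  exact hdec.rePred_exists

end Computability

/-- The all-E-graph-instance termination problem of equality saturation is undecidable:
there is a computable map from PCP instances to TRS instances such that the PCP instance
has a solution iff equality saturation terminates on every finite E-graph; in
particular, the problem is not decidable. -/
theorem eqsat_all_egraph_instance_termination_undecidable :
    (∃ g : PCPInstance → TRSInstance,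
      Computable (fun L : PCPInstance => Encodable.encode (g L)) ∧
      ∀ L : PCPInstance, PCPSolvable L ↔ AllEGraphTerminates (g L)) ∧
    ¬ ComputablePred (fun m : ℕ =>
        ∃ inst : TRSInstance, Encodable.encode inst = m ∧ AllEGraphTerminates inst) := by
  refine ⟨exists_reduction_of_rePred rePred_pcpSolvable, fun h => ?_⟩
  obtain ⟨g, hg, hgp⟩ := exists_reduction_of_rePred (ComputablePred.halting_problem_re 0)
  refine ComputablePred.halting_problem 0 (ComputablePred.computable_of_manyOneReducible
    ⟨fun c => Encodable.encode (g c), hg, fun c => ?_⟩ h)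
  simp only [hgp, Encodable.encode_inj, exists_eq_left]
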